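/- arXiv:1304.7878 — 13 statements merged into one kernel-verified Lean document; each statement's English description precedes it below -/
import Mathlib

section
/- Let F(b) = ∑_{i=1}^N ωᵢ (M θ_{i3}/δᵢ) · (θ_{i1} e^{θ_{i1} b} + θ_{i2} e^{−θ_{i2} b}) / ((θ_{i1}+θ_{i3}) e^{θ_{i1} b} + (θ_{i2}−θ_{i3}) e^{−θ_{i2} b}) − 1 for b ≥ 0. If ∑_{i=1}^N ωᵢ M θ_{i3}/δᵢ > 1, then the equation F(b) = 0 has a unique solution b in (0,∞). -/
open Real Finset

lemma aux_key (s μ M d p q : ℝ) (hs : 0 < s) (hd : 0 < d)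
    (hp : p ^ 2 = μ ^ 2 + 2 * s * d) (hq : q ^ 2 = (μ - M) ^ 2 + 2 * s * d)
    (hp1 : μ < p) (hq2 : M - μ < q) :
    M * ((μ - M + q) / s) / d * ((-μ + p) / s) < (-μ + p) / s + (μ - M + q) / s := by
  have h1 : 0 < p - μ := by linarith
  have h2 : 0 < q + μ - M := by linarith
  have h3 : 0 < (p - μ) * (q + μ - M) * (p + q - M) :=
    mul_pos (mul_pos h1 h2) (by linarith)
  have e : M * ((μ - M + q) / s) / d * ((-μ + p) / s)
      = (M * (μ - M + q) * (-μ + p)) / (s * s * d) := by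
    field_simp
  have e2 : (-μ + p) / s + (μ - M + q) / s = ((p + q - M) * (s * d)) / (s * s * d) := by
    field_simp
    ring
  rw [e, e2]
  apply div_lt_div_of_pos_right _ (by positivity)
  have e3 : 2 * ((p + q - M) * (s * d)) = (p - μ) * (q + μ - M) * (p + q + M) := by
    linear_combination (-(q + μ - M)) * hp - (p - μ) * hq
  nlinarith

lemma aux_den {a b c x : ℝ} (ha : 0 < a) (hb : 0 < b) (hc : 0 < c) (h0 : 0 ≤ x) (h1 : x ≤ 1) :
    0 < (a + c) + (b - c) * x := by
  nlinarith [mul_nonneg hb.le h0, mul_nonneg hc.le (sub_nonneg.2 h1)]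

lemma aux_mono {a b c x y : ℝ} (ha : 0 < a) (hb : 0 < b) (hc : 0 < c) (h0 : 0 ≤ x) (hxy : x < y)
    (h1 : y ≤ 1) :
    (a + b * x) / ((a + c) + (b - c) * x) < (a + b * y) / ((a + c) + (b - c) * y) := by
  rw [div_lt_div_iff₀ (aux_den ha hb hc h0 (by linarith)) (aux_den ha hb hc (by linarith) h1)]
  have : 0 < c * (a + b) * (y - x) := mul_pos (by positivity) (by linarith)
  nlinarith

theorem mixture_barrier_exists_unique
    (σ μ M : ℝ) (hσ : 0 < σ) (hμ : 0 < μ) (hM : 0 < M)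
    (N : ℕ) (hN : 1 ≤ N) (δ ω θ1 θ2 θ3 : Fin N → ℝ)
    (hδ : ∀ i, 0 < δ i) (hω : ∀ i, 0 < ω i) (hωsum : ∑ i, ω i = 1)
    (hθ1 : ∀ i, θ1 i = (-μ + Real.sqrt (μ ^ 2 + 2 * σ ^ 2 * δ i)) / σ ^ 2)
    (hθ2 : ∀ i, θ2 i = (μ + Real.sqrt (μ ^ 2 + 2 * σ ^ 2 * δ i)) / σ ^ 2)
    (hθ3 : ∀ i, θ3 i = ((μ - M) + Real.sqrt ((μ - M) ^ 2 + 2 * σ ^ 2 * δ i)) / σ ^ 2)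
    (F : ℝ → ℝ)
    (hF : ∀ b, F b = (∑ i, ω i * (M * θ3 i / δ i) *
        (θ1 i * Real.exp (θ1 i * b) + θ2 i * Real.exp (-θ2 i * b)) /
        ((θ1 i + θ3 i) * Real.exp (θ1 i * b) + (θ2 i - θ3 i) * Real.exp (-θ2 i * b))) - 1)
    (hcond : 1 < ∑ i, ω i * (M * θ3 i / δ i)) :
    ∃! b, b ∈ Set.Ioi (0 : ℝ) ∧ F b = 0 := by
  have hs : 0 < σ ^ 2 := by positivity
  have hA : ∀ i, Real.sqrt (μ ^ 2 + 2 * σ ^ 2 * δ i) ^ 2 = μ ^ 2 + 2 * σ ^ 2 * δ i := fun i =>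
    Real.sq_sqrt (by have := hδ i; positivity)
  have hB : ∀ i, Real.sqrt ((μ - M) ^ 2 + 2 * σ ^ 2 * δ i) ^ 2
      = (μ - M) ^ 2 + 2 * σ ^ 2 * δ i := fun i =>
    Real.sq_sqrt (by have := hδ i; positivity)
  have hp : ∀ i, μ < Real.sqrt (μ ^ 2 + 2 * σ ^ 2 * δ i) := fun i =>
    Real.lt_sqrt_of_sq_lt (by have := mul_pos hs (hδ i); linarith)
  have hq : ∀ i, M - μ < Real.sqrt ((μ - M) ^ 2 + 2 * σ ^ 2 * δ i) := fun i =>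
    Real.lt_sqrt_of_sq_lt (by have := mul_pos hs (hδ i); nlinarith)
  have h1 : ∀ i, 0 < θ1 i := fun i => by
    rw [hθ1]; exact div_pos (by linarith [hp i]) hs
  have h2 : ∀ i, 0 < θ2 i := fun i => by
    rw [hθ2]; exact div_pos (by linarith [hp i]) hs
  have h3 : ∀ i, 0 < θ3 i := fun i => by
    rw [hθ3]; exact div_pos (by linarith [hq i]) hs
  have key : ∀ i, M * θ3 i / δ i * θ1 i < θ1 i + θ3 i := fun i => by
    rw [hθ1, hθ3]
    exact aux_key _ _ _ _ _ _ hs (hδ i) (hA i) (hB i) (hp i) (hq i)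
  clear hθ1 hθ2 hθ3
  have hF' : ∀ b, F b = (∑ i, ω i * (M * θ3 i / δ i) *
      ((θ1 i + θ2 i * Real.exp (-(θ1 i + θ2 i) * b)) /
        ((θ1 i + θ3 i) + (θ2 i - θ3 i) * Real.exp (-(θ1 i + θ2 i) * b)))) - 1 := by
    intro b
    rw [hF]
    congr 1
    refine Finset.sum_congr rfl fun i _ => ?_
    have e : Real.exp (-θ2 i * b) = Real.exp (-(θ1 i + θ2 i) * b) * Real.exp (θ1 i * b) := by
      rw [← Real.exp_add]; congr 1; ring
    rw [e, mul_div_assoc]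
    congr 1
    symm
    rw [← mul_div_mul_right _ _ (Real.exp_pos (θ1 i * b)).ne']
    congr 1 <;> ring
  have hx0 : ∀ i b, 0 ≤ Real.exp (-(θ1 i + θ2 i) * b) := fun i b => (Real.exp_pos _).le
  have hx1 : ∀ i b, 0 ≤ b → Real.exp (-(θ1 i + θ2 i) * b) ≤ 1 := fun i b hb => by
    rw [Real.exp_le_one_iff]
    have := mul_nonneg (add_pos (h1 i) (h2 i)).le hb
    linarith
  have hne : (Finset.univ : Finset (Fin N)).Nonempty := ⟨⟨0, hN⟩, Finset.mem_univ _⟩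
  have hanti : ∀ x y, 0 ≤ x → x < y → F y < F x := by
    intro x y hx hxy
    rw [hF', hF']
    refine sub_lt_sub_right (Finset.sum_lt_sum_of_nonempty hne fun i _ => ?_) 1
    have hc : 0 < ω i * (M * θ3 i / δ i) :=
      mul_pos (hω i) (div_pos (mul_pos hM (h3 i)) (hδ i))
    refine mul_lt_mul_of_pos_left (aux_mono (h1 i) (h2 i) (h3 i) (hx0 i y) ?_ (hx1 i x hx)) hc
    rw [Real.exp_lt_exp]
    have := mul_lt_mul_of_pos_left hxy (add_pos (h1 i) (h2 i))
    linarith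
  have hcont : ContinuousOn F (Set.Ici 0) := by
    rw [show F = _ from funext hF']
    refine ContinuousOn.sub (continuousOn_finsetSum _ fun i _ => ?_) continuousOn_const
    refine ContinuousOn.mul continuousOn_const (ContinuousOn.div ?_ ?_ fun b hb => ?_)
    · fun_prop
    · fun_prop
    · exact (aux_den (h1 i) (h2 i) (h3 i) (hx0 i b) (hx1 i b hb)).ne'
  have hF0 : 0 < F 0 := by
    rw [hF']
    have : ∀ i, (θ1 i + θ2 i * Real.exp (-(θ1 i + θ2 i) * 0)) /
        ((θ1 i + θ3 i) + (θ2 i - θ3 i) * Real.exp (-(θ1 i + θ2 i) * 0)) = 1 := fun i => by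
      rw [mul_zero, Real.exp_zero]
      have := add_pos (h1 i) (h2 i)
      rw [div_eq_one_iff_eq (by linarith)]
      ring
    simp only [this, mul_one]
    linarith
  have hlim : Filter.Tendsto F Filter.atTop (nhds ((∑ i, ω i * (M * θ3 i / δ i) *
      ((θ1 i + θ2 i * 0) / ((θ1 i + θ3 i) + (θ2 i - θ3 i) * 0))) - 1)) := by
    rw [show F = _ from funext hF']
    refine Filter.Tendsto.sub_const (tendsto_finsetSum _ fun i _ => ?_) 1
    have hx : Filter.Tendsto (fun b => Real.exp (-(θ1 i + θ2 i) * b)) Filter.atTop (nhds 0) :=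
      Real.tendsto_exp_atBot.comp
        (Filter.tendsto_id.const_mul_atTop_of_neg (by linarith [h1 i, h2 i]))
    refine Filter.Tendsto.const_mul _ (Filter.Tendsto.div
      ((hx.const_mul _).const_add _) ((hx.const_mul _).const_add _) ?_)
    have := add_pos (h1 i) (h3 i)
    linarith
  have hneg : (∑ i, ω i * (M * θ3 i / δ i) *
      ((θ1 i + θ2 i * 0) / ((θ1 i + θ3 i) + (θ2 i - θ3 i) * 0))) - 1 < 0 := by
    rw [← hωsum, sub_neg]
    refine Finset.sum_lt_sum_of_nonempty hne fun i _ => ?_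
    rw [mul_zero, mul_zero, add_zero, add_zero, mul_assoc]
    refine mul_lt_of_lt_one_right (hω i) ?_
    rw [← mul_div_assoc, div_lt_one (add_pos (h1 i) (h3 i))]
    exact key i
  obtain ⟨B, hB1, hB0⟩ :=
    ((hlim.eventually_lt_const hneg).and (Filter.eventually_ge_atTop (0 : ℝ))).exists
  obtain ⟨b, hb, hb0⟩ := intermediate_value_Icc' hB0
    (hcont.mono Set.Icc_subset_Ici_self) ⟨hB1.le, hF0.le⟩
  have hbpos : 0 < b := lt_of_le_of_ne hb.1 (by rintro rfl; linarith)
  refine ⟨b, ⟨hbpos, hb0⟩, ?_⟩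
  rintro y ⟨hy, hy0⟩
  have hy' : 0 < y := hy
  rcases lt_trichotomy y b with h | h | h
  · linarith [hanti y b hy'.le h]
  · exact h
  · linarith [hanti b y hbpos.le h]
end

section
/- Let F(b) = ∑_{i=1}^N ωᵢ (M θ_{i3}/δᵢ) · (θ_{i1} e^{θ_{i1} b} + θ_{i2} e^{−θ_{i2} b}) / ((θ_{i1}+θ_{i3}) e^{θ_{i1} b} + (θ_{i2}−θ_{i3}) e^{−θ_{i2} b}) − 1 for b ≥ 0. Then F is strictly decreasing on [0,∞); in particular its derivative satisfies F′(b) = ∑_{i=1}^N ωᵢ (M θ_{i3}/δᵢ) · (−θ_{i3}(θ_{i1}+θ_{i2})² e^{(θ_{i1}−θ_{i2})b}) / ((θ_{i1}+θ_{i3}) e^{θ_{i1} b} + (θ_{i2}−θ_{i3}) e^{−θ_{i2} b})² < 0 for every b ≥ 0. -/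
open Real Finset

theorem mixture_F_strict_anti
    (σ μ M : ℝ) (hσ : 0 < σ) (hμ : 0 < μ) (hM : 0 < M)
    (N : ℕ) (hN : 1 ≤ N) (δ ω θ1 θ2 θ3 : Fin N → ℝ)
    (hδ : ∀ i, 0 < δ i) (hω : ∀ i, 0 < ω i) (hωsum : ∑ i, ω i = 1)
    (hθ1 : ∀ i, θ1 i = (-μ + Real.sqrt (μ ^ 2 + 2 * σ ^ 2 * δ i)) / σ ^ 2)
    (hθ2 : ∀ i, θ2 i = (μ + Real.sqrt (μ ^ 2 + 2 * σ ^ 2 * δ i)) / σ ^ 2)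
    (hθ3 : ∀ i, θ3 i = ((μ - M) + Real.sqrt ((μ - M) ^ 2 + 2 * σ ^ 2 * δ i)) / σ ^ 2)
    (F : ℝ → ℝ)
    (hF : ∀ b, F b = (∑ i, ω i * (M * θ3 i / δ i) *
        (θ1 i * Real.exp (θ1 i * b) + θ2 i * Real.exp (-θ2 i * b)) /
        ((θ1 i + θ3 i) * Real.exp (θ1 i * b) + (θ2 i - θ3 i) * Real.exp (-θ2 i * b))) - 1)
 :
    StrictAntiOn F (Set.Ici 0) ∧
    ∀ b : ℝ, 0 ≤ b →
      deriv F b = ∑ i, ω i * (M * θ3 i / δ i) *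
        (-(θ3 i) * (θ1 i + θ2 i) ^ 2 * Real.exp ((θ1 i - θ2 i) * b)) /
        ((θ1 i + θ3 i) * Real.exp (θ1 i * b) + (θ2 i - θ3 i) * Real.exp (-θ2 i * b)) ^ 2 ∧
      deriv F b < 0 := by
  have h1 : ∀ i, 0 < θ1 i := by
    intro i
    have hk : 0 < 2 * σ ^ 2 * δ i := by have := hδ i; positivity
    rw [hθ1]
    have : μ < √(μ ^ 2 + 2 * σ ^ 2 * δ i) := Real.lt_sqrt_of_sq_lt (by linarith)
    have h2 : 0 < -μ + √(μ ^ 2 + 2 * σ ^ 2 * δ i) := by linarith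
    positivity
  have h3 : ∀ i, 0 < θ3 i := by
    intro i
    have hk : 0 < 2 * σ ^ 2 * δ i := by have := hδ i; positivity
    rw [hθ3]
    have : -(μ - M) < √((μ - M) ^ 2 + 2 * σ ^ 2 * δ i) :=
      Real.lt_sqrt_of_sq_lt (by rw [neg_sq]; linarith)
    have h2 : 0 < (μ - M) + √((μ - M) ^ 2 + 2 * σ ^ 2 * δ i) := by linarith
    positivity
  have h23 : ∀ i, 0 ≤ θ2 i - θ3 i := by
    intro i
    have hk : 0 < 2 * σ ^ 2 * δ i := by have := hδ i; positivity
    rw [hθ2, hθ3, ← sub_div]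
    apply div_nonneg _ (by positivity)
    have hs := Real.sqrt_nonneg (μ ^ 2 + 2 * σ ^ 2 * δ i)
    have hq := Real.sq_sqrt (show 0 ≤ μ ^ 2 + 2 * σ ^ 2 * δ i by positivity)
    have : √((μ - M) ^ 2 + 2 * σ ^ 2 * δ i) ≤ √(μ ^ 2 + 2 * σ ^ 2 * δ i) + M := by
      apply Real.sqrt_le_iff.mpr
      refine ⟨by linarith, ?_⟩
      nlinarith [mul_pos hμ hM, mul_nonneg hs hM.le]
    linarith
  have hD : ∀ i b, 0 < (θ1 i + θ3 i) * Real.exp (θ1 i * b)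
      + (θ2 i - θ3 i) * Real.exp (-θ2 i * b) := by
    intro i b
    have a1 := mul_pos (add_pos (h1 i) (h3 i)) (Real.exp_pos (θ1 i * b))
    have a2 := mul_nonneg (h23 i) (Real.exp_pos (-θ2 i * b)).le
    linarith
  have hder : ∀ b, HasDerivAt F (∑ i, ω i * (M * θ3 i / δ i) *
        (-(θ3 i) * (θ1 i + θ2 i) ^ 2 * Real.exp ((θ1 i - θ2 i) * b)) /
        ((θ1 i + θ3 i) * Real.exp (θ1 i * b) + (θ2 i - θ3 i) * Real.exp (-θ2 i * b)) ^ 2) b := by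
    intro b
    rw [show F = _ from funext hF]
    apply HasDerivAt.sub_const
    apply HasDerivAt.fun_sum
    intro i _
    have e1 : HasDerivAt (fun b => Real.exp (θ1 i * b)) (Real.exp (θ1 i * b) * θ1 i) b := by
      simpa using ((hasDerivAt_id b).const_mul (θ1 i)).exp
    have e2 : HasDerivAt (fun b => Real.exp (-θ2 i * b)) (Real.exp (-θ2 i * b) * -θ2 i) b := by
      simpa using ((hasDerivAt_id b).const_mul (-θ2 i)).exp
    have hn := ((e1.const_mul (θ1 i)).add (e2.const_mul (θ2 i))).const_mul
      (ω i * (M * θ3 i / δ i))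
    have hd := (e1.const_mul (θ1 i + θ3 i)).add (e2.const_mul (θ2 i - θ3 i))
    have hq := hn.div hd (hD i b).ne'
    refine hq.congr_deriv ?_
    have hx : Real.exp ((θ1 i - θ2 i) * b) = Real.exp (θ1 i * b) * Real.exp (-θ2 i * b) := by
      rw [← Real.exp_add]; congr 1; ring
    rw [hx]
    simp only [Pi.add_apply]
    congr 1
    ring
  have hneg : ∀ b, deriv F b < 0 := by
    intro b
    rw [(hder b).deriv]
    apply Finset.sum_neg
    · intro i _
      have := hD i b
      have h12 : 0 < θ1 i + θ2 i := by linarith [h1 i, h3 i, h23 i]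
      apply div_neg_of_neg_of_pos _ (by positivity)
      have a1 := h3 i
      have a2 := hδ i
      have a3 := hω i
      apply mul_neg_of_pos_of_neg (by positivity)
      have : 0 < θ3 i * (θ1 i + θ2 i) ^ 2 * Real.exp ((θ1 i - θ2 i) * b) := by positivity
      linarith
    · exact ⟨⟨0, hN⟩, Finset.mem_univ _⟩
  exact ⟨(strictAnti_of_deriv_neg hneg).strictAntiOn _, fun b _ => ⟨(hder b).deriv, hneg b⟩⟩
end

section
/- Let F(b) = ∑_{i=1}^N ωᵢ (M θ_{i3}/δᵢ) · (θ_{i1} e^{θ_{i1} b} + θ_{i2} e^{−θ_{i2} b}) / ((θ_{i1}+θ_{i3}) e^{θ_{i1} b} + (θ_{i2}−θ_{i3}) e^{−θ_{i2} b}) − 1 for b ≥ 0. Then lim_{b→∞} F(b) = ∑_{i=1}^N ωᵢ (M θ_{i3}/δᵢ) · θ_{i1}/(θ_{i1}+θ_{i3}) − 1, and this limit is strictly negative. -/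
open Real Finset Filter

/-- Positivity and quadratic equation for the root. -/
lemma root_aux (s e c x : ℝ) (hs : 0 < s) (hc : 0 < c)
    (hx : x = (e + Real.sqrt (e ^ 2 + 2 * s ^ 2 * c)) / s ^ 2) :
    0 < x ∧ s ^ 2 * x ^ 2 / 2 - e * x = c := by
  have h2 : 0 < s ^ 2 := by positivity
  have hp : 0 < 2 * s ^ 2 * c := by positivity
  have hq := Real.sq_sqrt (show 0 ≤ e ^ 2 + 2 * s ^ 2 * c by positivity)
  have hlt : |e| < Real.sqrt (e ^ 2 + 2 * s ^ 2 * c) := by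
    rw [← Real.sqrt_sq_eq_abs]
    exact Real.sqrt_lt_sqrt (sq_nonneg e) (by linarith)
  have hneg := neg_abs_le e
  set r := Real.sqrt (e ^ 2 + 2 * s ^ 2 * c)
  refine ⟨by rw [hx]; exact div_pos (by linarith) h2, ?_⟩
  rw [hx]
  field_simp
  linarith

lemma term_limit (k a b c : ℝ) (ha : 0 < a) (hb : 0 < b) (hc : 0 < c) :
    Tendsto (fun t : ℝ => k * (a * Real.exp (a * t) + b * Real.exp (-b * t)) /
      ((a + c) * Real.exp (a * t) + (b - c) * Real.exp (-b * t))) atTop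
      (nhds (k * (a / (a + c)))) := by
  have he : Tendsto (fun t : ℝ => Real.exp (-((a + b) * t))) atTop (nhds 0) :=
    Real.tendsto_exp_neg_atTop_nhds_zero.comp
      (tendsto_id.const_mul_atTop (by linarith : 0 < a + b))
  have h1 : Tendsto (fun t : ℝ => k * (a + b * Real.exp (-((a + b) * t))) /
      ((a + c) + (b - c) * Real.exp (-((a + b) * t)))) atTop
      (nhds (k * (a + b * 0) / ((a + c) + (b - c) * 0))) := by
    apply Tendsto.div
    · exact ((he.const_mul b).const_add a).const_mul k
    · exact (he.const_mul (b - c)).const_add (a + c)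
    · simp only [mul_zero, add_zero]
      positivity
  have h2 : k * (a + b * 0) / ((a + c) + (b - c) * 0) = k * (a / (a + c)) := by
    simp [mul_div_assoc]
  rw [h2] at h1
  refine h1.congr fun t => ?_
  have h3 : Real.exp (-b * t) = Real.exp (-((a + b) * t)) * Real.exp (a * t) := by
    rw [← Real.exp_add]
    congr 1
    ring
  rw [h3, ← mul_div_mul_right _ _ (Real.exp_pos (a * t)).ne']
  congr 1 <;> ring

theorem mixture_F_limit_at_top
    (σ μ M : ℝ) (hσ : 0 < σ) (hμ : 0 < μ) (hM : 0 < M)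
    (N : ℕ) (hN : 1 ≤ N) (δ ω θ1 θ2 θ3 : Fin N → ℝ)
    (hδ : ∀ i, 0 < δ i) (hω : ∀ i, 0 < ω i) (hωsum : ∑ i, ω i = 1)
    (hθ1 : ∀ i, θ1 i = (-μ + Real.sqrt (μ ^ 2 + 2 * σ ^ 2 * δ i)) / σ ^ 2)
    (hθ2 : ∀ i, θ2 i = (μ + Real.sqrt (μ ^ 2 + 2 * σ ^ 2 * δ i)) / σ ^ 2)
    (hθ3 : ∀ i, θ3 i = ((μ - M) + Real.sqrt ((μ - M) ^ 2 + 2 * σ ^ 2 * δ i)) / σ ^ 2)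
    (F : ℝ → ℝ)
    (hF : ∀ b, F b = (∑ i, ω i * (M * θ3 i / δ i) *
        (θ1 i * Real.exp (θ1 i * b) + θ2 i * Real.exp (-θ2 i * b)) /
        ((θ1 i + θ3 i) * Real.exp (θ1 i * b) + (θ2 i - θ3 i) * Real.exp (-θ2 i * b))) - 1)
 :
    Tendsto F atTop
      (nhds ((∑ i, ω i * (M * θ3 i / δ i) * (θ1 i / (θ1 i + θ3 i))) - 1)) ∧
    (∑ i, ω i * (M * θ3 i / δ i) * (θ1 i / (θ1 i + θ3 i))) - 1 < 0 := by
  have r1 : ∀ i, 0 < θ1 i ∧ σ ^ 2 * θ1 i ^ 2 / 2 - (-μ) * θ1 i = δ i := fun i =>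
    root_aux σ (-μ) (δ i) (θ1 i) hσ (hδ i) (by rw [hθ1, neg_sq])
  have r2 := fun i => root_aux σ μ (δ i) (θ2 i) hσ (hδ i) (hθ2 i)
  have r3 := fun i => root_aux σ (μ - M) (δ i) (θ3 i) hσ (hδ i) (hθ3 i)
  constructor
  · rw [show F = _ from funext hF]
    apply Tendsto.sub_const
    apply tendsto_finsetSum
    intro i _
    exact term_limit _ _ _ _ (r1 i).1 (r2 i).1 (r3 i).1
  · rw [sub_neg, ← hωsum]
    apply Finset.sum_lt_sum_of_nonempty
    · exact ⟨⟨0, hN⟩, Finset.mem_univ _⟩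
    intro i _
    obtain ⟨ha, ea⟩ := r1 i
    obtain ⟨hc, ec⟩ := r3 i
    have hd := hδ i
    rw [mul_assoc]
    apply mul_lt_of_lt_one_right (hω i)
    rw [div_mul_div_comm, div_lt_one (by positivity)]
    have hp : 0 < σ ^ 2 * (θ1 i * θ3 i * (θ1 i + θ3 i)) := by positivity
    have e : δ i * (θ1 i + θ3 i) = σ ^ 2 * (θ1 i * θ3 i * (θ1 i + θ3 i)) / 2
        + M * θ3 i * θ1 i := by
      linear_combination (-θ3 i) * ea - θ1 i * ec
    linarith
end

section
/- For each i = 1,…,N define Vᵢ(x) = (M/δᵢ)(1 − e^{−θ_{i3} x}) for x ≥ 0. Then: (a) Vᵢ(0) = 0 and (1/2)σ² Vᵢ″(x) + (μ − M) Vᵢ′(x) − δᵢ Vᵢ(x) + M = 0 for all x ≥ 0; (b) if ∑_{i=1}^N ωᵢ M θ_{i3}/δᵢ ≤ 1, then V := ∑_{i=1}^N ωᵢ Vᵢ satisfies 0 < V′(x) ≤ 1 and V″(x) < 0 for all x ≥ 0. -/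
open Real Finset

theorem mixture_always_pay_value_function
    (σ μ M : ℝ) (hσ : 0 < σ) (hμ : 0 < μ) (hM : 0 < M)
    (N : ℕ) (hN : 1 ≤ N) (δ ω θ1 θ2 θ3 : Fin N → ℝ)
    (hδ : ∀ i, 0 < δ i) (hω : ∀ i, 0 < ω i) (hωsum : ∑ i, ω i = 1)
    (hθ1 : ∀ i, θ1 i = (-μ + Real.sqrt (μ ^ 2 + 2 * σ ^ 2 * δ i)) / σ ^ 2)
    (hθ2 : ∀ i, θ2 i = (μ + Real.sqrt (μ ^ 2 + 2 * σ ^ 2 * δ i)) / σ ^ 2)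
    (hθ3 : ∀ i, θ3 i = ((μ - M) + Real.sqrt ((μ - M) ^ 2 + 2 * σ ^ 2 * δ i)) / σ ^ 2)
    (V : Fin N → ℝ → ℝ)
    (hV : ∀ i x, V i x = (M / δ i) * (1 - Real.exp (-θ3 i * x))) :
    (∀ i, V i 0 = 0 ∧ ∀ x : ℝ, 0 ≤ x →
      (1 / 2) * σ ^ 2 * deriv (deriv (V i)) x + (μ - M) * deriv (V i) x
        - δ i * V i x + M = 0) ∧
    ((∑ i, ω i * (M * θ3 i / δ i)) ≤ 1 →
      ∀ x : ℝ, 0 ≤ x →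
        (0 < deriv (fun y => ∑ i, ω i * V i y) x ∧
          deriv (fun y => ∑ i, ω i * V i y) x ≤ 1) ∧
        deriv (deriv (fun y => ∑ i, ω i * V i y)) x < 0) := by
  have hs : ∀ i, 0 < θ3 i ∧ 1 / 2 * σ ^ 2 * θ3 i ^ 2 - (μ - M) * θ3 i - δ i = 0 := by
    intro i
    have hpos : 0 < 2 * σ ^ 2 * δ i := by have := hδ i; positivity
    have hsq := Real.sq_sqrt (show 0 ≤ (μ - M) ^ 2 + 2 * σ ^ 2 * δ i by positivity)
    have hlt : |μ - M| < Real.sqrt ((μ - M) ^ 2 + 2 * σ ^ 2 * δ i) := by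
      rw [← Real.sqrt_sq_eq_abs]
      exact Real.sqrt_lt_sqrt (sq_nonneg _) (by linarith)
    have h3 := hθ3 i
    generalize Real.sqrt ((μ - M) ^ 2 + 2 * σ ^ 2 * δ i) = s at *
    constructor
    · rw [h3]
      have := neg_abs_le (μ - M)
      apply div_pos (by linarith) (by positivity)
    · have h4 : σ ^ 2 * θ3 i = (μ - M) + s := by
        rw [h3]; field_simp
      have hσ2 : σ ^ 2 ≠ 0 := by positivity
      apply mul_left_cancel₀ hσ2
      have h5 : s = σ ^ 2 * θ3 i - (μ - M) := by linarith
      rw [h5] at hsq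
      linarith
  have hE : ∀ i x, HasDerivAt (fun y => Real.exp (-θ3 i * y))
      (Real.exp (-θ3 i * x) * (-θ3 i)) x := by
    intro i x
    have h := ((hasDerivAt_id x).const_mul (-θ3 i)).exp
    simpa using h
  have hD1 : ∀ i x, HasDerivAt (V i) (M * θ3 i / δ i * Real.exp (-θ3 i * x)) x := by
    intro i x
    rw [show V i = fun y => (M / δ i) * (1 - Real.exp (-θ3 i * y)) from funext (hV i)]
    have h := ((hE i x).const_sub 1).const_mul (M / δ i)
    exact h.congr_deriv (by ring)
  have hD2 : ∀ i x, HasDerivAt (fun y => M * θ3 i / δ i * Real.exp (-θ3 i * y))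
      (-(M * θ3 i ^ 2 / δ i * Real.exp (-θ3 i * x))) x := by
    intro i x
    have h := (hE i x).const_mul (M * θ3 i / δ i)
    exact h.congr_deriv (by ring)
  have hne : (Finset.univ : Finset (Fin N)).Nonempty := ⟨⟨0, hN⟩, Finset.mem_univ _⟩
  constructor
  · intro i
    refine ⟨by simp [hV], fun x _ => ?_⟩
    have e1 : deriv (V i) = fun y => M * θ3 i / δ i * Real.exp (-θ3 i * y) :=
      funext fun y => (hD1 i y).deriv
    rw [e1, (hD2 i x).deriv, hV]
    have hd := (hδ i).ne'
    have hq := (hs i).2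
    have key : δ i * (M / δ i * (1 - Real.exp (-θ3 i * x)))
        = M / δ i * (δ i - δ i * Real.exp (-θ3 i * x)) := by ring
    have hMd : M / δ i * δ i = M := by field_simp
    linear_combination (-(M / δ i * Real.exp (-θ3 i * x))) * hq - hMd
  · intro hsum x hx
    have e1 : deriv (fun y => ∑ i, ω i * V i y)
        = fun y => ∑ i, ω i * (M * θ3 i / δ i * Real.exp (-θ3 i * y)) :=
      funext fun y => (HasDerivAt.fun_sum fun i _ => (hD1 i y).const_mul (ω i)).deriv
    rw [e1, (HasDerivAt.fun_sum fun i _ => (hD2 i x).const_mul (ω i)).deriv]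
    refine ⟨⟨?_, ?_⟩, ?_⟩
    · refine Finset.sum_pos (fun i _ => ?_) hne
      have := hδ i
      have := hω i
      have := (hs i).1
      positivity
    · refine le_trans (Finset.sum_le_sum fun i _ => ?_) hsum
      have := hδ i
      have := hω i
      have h3 := (hs i).1
      have hexp : Real.exp (-θ3 i * x) ≤ 1 :=
        Real.exp_le_one_iff.mpr (by nlinarith)
      exact mul_le_mul_of_nonneg_left
        (mul_le_of_le_one_right (by positivity) hexp) (by positivity)
    · refine Finset.sum_neg (fun i _ => ?_) hne
      have := hδ i
      have := hω i
      have := (hs i).1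
      rw [mul_neg]
      apply neg_neg_of_pos
      positivity
end

section
/- For any b ≥ 0 and each i = 1,…,N, define Cᵢ = (M θ_{i3}/δᵢ) · [(θ_{i1}+θ_{i3}) e^{θ_{i1} b} + (θ_{i2}−θ_{i3}) e^{−θ_{i2} b}]^{−1} and dᵢ = (M/δᵢ) e^{θ_{i3} b} (θ_{i1} e^{θ_{i1} b} + θ_{i2} e^{−θ_{i2} b}) / [(θ_{i1}+θ_{i3}) e^{θ_{i1} b} + (θ_{i2}−θ_{i3}) e^{−θ_{i2} b}]. Then Cᵢ > 0, dᵢ > 0, and the value-matching and smooth-pasting equations hold: Cᵢ(e^{θ_{i1} b} − e^{−θ_{i2} b}) = M/δᵢ − dᵢ e^{−θ_{i3} b} and Cᵢ(θ_{i1} e^{θ_{i1} b} + θ_{i2} e^{−θ_{i2} b}) = dᵢ θ_{i3} e^{−θ_{i3} b}. -/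
open Real Finset

theorem mixture_smooth_fit_coefficients
    (σ μ M : ℝ) (hσ : 0 < σ) (hμ : 0 < μ) (hM : 0 < M)
    (N : ℕ) (hN : 1 ≤ N) (δ ω θ1 θ2 θ3 : Fin N → ℝ)
    (hδ : ∀ i, 0 < δ i) (hω : ∀ i, 0 < ω i) (hωsum : ∑ i, ω i = 1)
    (hθ1 : ∀ i, θ1 i = (-μ + Real.sqrt (μ ^ 2 + 2 * σ ^ 2 * δ i)) / σ ^ 2)
    (hθ2 : ∀ i, θ2 i = (μ + Real.sqrt (μ ^ 2 + 2 * σ ^ 2 * δ i)) / σ ^ 2)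
    (hθ3 : ∀ i, θ3 i = ((μ - M) + Real.sqrt ((μ - M) ^ 2 + 2 * σ ^ 2 * δ i)) / σ ^ 2)
    (b : ℝ) (hb : 0 ≤ b)
    (C d : Fin N → ℝ)
    (hC : ∀ i, C i = (M * θ3 i / δ i) *
        ((θ1 i + θ3 i) * Real.exp (θ1 i * b) + (θ2 i - θ3 i) * Real.exp (-θ2 i * b))⁻¹)
    (hd : ∀ i, d i = (M / δ i) * Real.exp (θ3 i * b) *
        (θ1 i * Real.exp (θ1 i * b) + θ2 i * Real.exp (-θ2 i * b)) /
        ((θ1 i + θ3 i) * Real.exp (θ1 i * b) + (θ2 i - θ3 i) * Real.exp (-θ2 i * b)))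
 :
    ∀ i, 0 < C i ∧ 0 < d i ∧
      C i * (Real.exp (θ1 i * b) - Real.exp (-θ2 i * b))
        = M / δ i - d i * Real.exp (-θ3 i * b) ∧
      C i * (θ1 i * Real.exp (θ1 i * b) + θ2 i * Real.exp (-θ2 i * b))
        = d i * θ3 i * Real.exp (-θ3 i * b) := by
  intro i
  have hs : 0 < 2 * σ ^ 2 * δ i := by have := hδ i; positivity
  have key : ∀ x : ℝ, |x| < Real.sqrt (x ^ 2 + 2 * σ ^ 2 * δ i) := fun x => by
    rw [← Real.sqrt_sq_eq_abs]
    exact Real.sqrt_lt_sqrt (sq_nonneg x) (by linarith)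
  have h1 : 0 < θ1 i := by
    rw [hθ1]
    have := (abs_lt.1 (key μ)).2
    exact div_pos (by linarith) (by positivity)
  have h2 : 0 < θ2 i := by
    rw [hθ2]
    have := (abs_lt.1 (key μ)).1
    exact div_pos (by linarith) (by positivity)
  have h3 : 0 < θ3 i := by
    rw [hθ3]
    have := (abs_lt.1 (key (μ - M))).1
    exact div_pos (by linarith) (by positivity)
  have hδi := hδ i
  have hE : Real.exp (-θ2 i * b) ≤ Real.exp (θ1 i * b) := by
    apply Real.exp_le_exp.2
    nlinarith [mul_nonneg h1.le hb, mul_nonneg h2.le hb]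
  have e1 : 0 < Real.exp (θ1 i * b) := Real.exp_pos _
  have e2 : 0 < Real.exp (-θ2 i * b) := Real.exp_pos _
  have e3 : 0 < Real.exp (θ3 i * b) := Real.exp_pos _
  have h4 : Real.exp (-θ3 i * b) = (Real.exp (θ3 i * b))⁻¹ := by
    rw [← Real.exp_neg, neg_mul]
  rw [hC, hd, h4]
  generalize Real.exp (θ1 i * b) = A at *
  generalize Real.exp (-θ2 i * b) = B at *
  generalize Real.exp (θ3 i * b) = E at *
  have hD : 0 < (θ1 i + θ3 i) * A + (θ2 i - θ3 i) * B := by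
    nlinarith [mul_pos h1 e1, mul_pos h2 e2, mul_nonneg h3.le (sub_nonneg.2 hE)]
  obtain ⟨D, hDe⟩ : ∃ D, D = (θ1 i + θ3 i) * A + (θ2 i - θ3 i) * B := ⟨_, rfl⟩
  rw [← hDe] at hD ⊢
  refine ⟨by positivity, by positivity, ?_, ?_⟩
  · field_simp
    rw [hDe]; ring
  · field_simp
end

section
/- Suppose (δ/M − θ₃)/(1/(μ−M−σ²θ₃) + θ₃/δ) < λ < (θ₁+θ₃)[(δ/M)(θ₁+θ₃) − θ₁θ₃] / [θ₁²(1/(μ−M−σ²θ₃) + θ₃/δ) + θ₃²(θ₁/δ − 1/(μ+σ²θ₁))]. Then the equation G(b) = 0 has a solution b in (0,∞). -/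
open Real

theorem barrier_aux_ivt (P : ℝ → ℝ) (hc : Continuous P) (h0 : 0 < P 0) (L : ℝ) (hL : L < 0)
    (hlim : Filter.Tendsto P Filter.atTop (nhds L)) : ∃ b : ℝ, 0 < b ∧ P b = 0 := by
  obtain ⟨N, hN, hN0⟩ :=
    ((hlim.eventually_lt_const hL).and (Filter.eventually_ge_atTop (0:ℝ))).exists
  obtain ⟨b, hb, hPb⟩ := intermediate_value_Icc' hN0 hc.continuousOn ⟨hN.le, h0.le⟩
  refine ⟨b, lt_of_le_of_ne hb.1 ?_, hPb⟩
  rintro rfl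
  linarith

theorem barrier_aux_exp (c : ℝ) (hc : 0 < c) :
    Filter.Tendsto (fun b : ℝ => Real.exp (-(c * b))) Filter.atTop (nhds 0) ∧
    Filter.Tendsto (fun b : ℝ => b * Real.exp (-(c * b))) Filter.atTop (nhds 0) := by
  have hm : Filter.Tendsto (fun b : ℝ => c * b) Filter.atTop Filter.atTop :=
    Filter.tendsto_id.const_mul_atTop hc
  refine ⟨(Real.tendsto_exp_neg_atTop_nhds_zero).comp hm, ?_⟩
  have h := ((Real.tendsto_pow_mul_exp_neg_atTop_nhds_zero 1).comp hm).const_mul (c⁻¹)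
  simp only [mul_zero] at h
  refine h.congr fun b => ?_
  simp only [Function.comp, pow_one]
  field_simp

theorem barrier_aux_alg (lam M δ s1 s3 θ1 θ2 θ3 A1 A2 E F T b D : ℝ)
    (hD : D = (θ1 + θ3) * E + (θ2 - θ3) * F) (hD0 : D ≠ 0) (hE : E ≠ 0) (hT : T ≠ 0) :
    -θ3 * (lam * (M * θ3 / δ * D⁻¹) / s1) * E ^ 2 + θ3 * (lam * (M * θ3 / δ * D⁻¹) / s1) * F ^ 2
      + θ1 * (lam * (M / δ * T * (θ1 * E + θ2 * F) / D) / -s3) * (E / T)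
      + θ2 * (lam * (M / δ * T * (θ1 * E + θ2 * F) / D) / -s3) * (F / T)
      + 2 * (θ1 + θ2) * θ3 * (lam * (M * θ3 / δ * D⁻¹) / s1) * b * (E * F)
      + A1 * E + A2 * F = (-θ3 * (lam * (M * θ3 / δ) / s1)
      + θ3 * (lam * (M * θ3 / δ) / s1) * (F / E) ^ 2
      + lam * (M / δ) / (-s3) * (θ1 + θ2 * (F / E)) ^ 2
      + 2 * (θ1 + θ2) * θ3 * (lam * (M * θ3 / δ) / s1) * (b * (F / E))
      + (A1 + A2 * (F / E)) * (θ1 + θ3 + (θ2 - θ3) * (F / E))) * E ^ 2 / D := by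
  have h1 : θ1 + θ3 + (θ2 - θ3) * (F / E) = D / E := by rw [hD]; field_simp
  have h2 : θ1 + θ2 * (F / E) = (θ1 * E + θ2 * F) / E := by field_simp
  have h3 : A1 + A2 * (F / E) = (A1 * E + A2 * F) / E := by field_simp
  have g1 : lam * (M * θ3 / δ * D⁻¹) / s1 = lam * (M * θ3 / δ) / s1 / D := by ring
  have g2 : lam * (M / δ * T * (θ1 * E + θ2 * F) / D) / -s3
      = lam * (M / δ) / (-s3) * (T * (θ1 * E + θ2 * F) / D) := by ring
  rw [h1, h2, h3, g1, g2]
  generalize lam * (M * θ3 / δ) / s1 = k1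
  generalize lam * (M / δ) / (-s3) = k3
  clear hD h1 h2 h3 g1 g2
  field_simp
  ring

set_option maxHeartbeats 2000000 in
theorem pseudo_exponential_barrier_exists
    (σ μ M δ : ℝ) (hσ : 0 < σ) (hμ : 0 < μ) (hM : 0 < M) (hδ : 0 < δ)
    (lam : ℝ) (hlam0 : 0 < lam) (hlamδ : lam < δ)
    (θ1 θ2 θ3 : ℝ)
    (hθ1 : θ1 = (-μ + Real.sqrt (μ ^ 2 + 2 * σ ^ 2 * δ)) / σ ^ 2)
    (hθ2 : θ2 = (μ + Real.sqrt (μ ^ 2 + 2 * σ ^ 2 * δ)) / σ ^ 2)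
    (hθ3 : θ3 = ((μ - M) + Real.sqrt ((μ - M) ^ 2 + 2 * σ ^ 2 * δ)) / σ ^ 2)
    (G : ℝ → ℝ)
    (hG : ∀ b, G b =
      -θ3 * (lam * ((M * θ3 / δ) *
          ((θ1 + θ3) * Real.exp (θ1 * b) + (θ2 - θ3) * Real.exp (-θ2 * b))⁻¹) / (μ + σ ^ 2 * θ1))
        * Real.exp (2 * θ1 * b)
      + θ3 * (lam * ((M * θ3 / δ) *
          ((θ1 + θ3) * Real.exp (θ1 * b) + (θ2 - θ3) * Real.exp (-θ2 * b))⁻¹) / (μ + σ ^ 2 * θ1))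
        * Real.exp (-2 * θ2 * b)
      + θ1 * (lam * ((M / δ) * Real.exp (θ3 * b) *
          (θ1 * Real.exp (θ1 * b) + θ2 * Real.exp (-θ2 * b)) /
          ((θ1 + θ3) * Real.exp (θ1 * b) + (θ2 - θ3) * Real.exp (-θ2 * b))) / (μ - M - σ ^ 2 * θ3))
        * Real.exp ((θ1 - θ3) * b)
      + θ2 * (lam * ((M / δ) * Real.exp (θ3 * b) *
          (θ1 * Real.exp (θ1 * b) + θ2 * Real.exp (-θ2 * b)) /
          ((θ1 + θ3) * Real.exp (θ1 * b) + (θ2 - θ3) * Real.exp (-θ2 * b))) / (μ - M - σ ^ 2 * θ3))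
        * Real.exp (-(θ2 + θ3) * b)
      + 2 * (θ1 + θ2) * θ3 * (lam * ((M * θ3 / δ) *
          ((θ1 + θ3) * Real.exp (θ1 * b) + (θ2 - θ3) * Real.exp (-θ2 * b))⁻¹) / (μ + σ ^ 2 * θ1))
        * b * Real.exp ((θ1 - θ2) * b)
      + (θ1 * θ3 * (1 + lam / δ) * (M / δ) - (θ1 + θ3)) * Real.exp (θ1 * b)
      + (θ2 * θ3 * (1 + lam / δ) * (M / δ) - (θ2 - θ3)) * Real.exp (-θ2 * b))
    (hlow : (δ / M - θ3) / (1 / (μ - M - σ ^ 2 * θ3) + θ3 / δ) < lam)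
    (hhigh : lam < (θ1 + θ3) * ((δ / M) * (θ1 + θ3) - θ1 * θ3) /
      (θ1 ^ 2 * (1 / (μ - M - σ ^ 2 * θ3) + θ3 / δ) +
        θ3 ^ 2 * (θ1 / δ - 1 / (μ + σ ^ 2 * θ1)))) :
    ∃ b : ℝ, 0 < b ∧ G b = 0 := by
  have hs1 : Real.sqrt (μ ^ 2 + 2 * σ ^ 2 * δ) ^ 2 = μ ^ 2 + 2 * σ ^ 2 * δ :=
    Real.sq_sqrt (by positivity)
  have hs3 : Real.sqrt ((μ - M) ^ 2 + 2 * σ ^ 2 * δ) ^ 2 = (μ - M) ^ 2 + 2 * σ ^ 2 * δ :=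
    Real.sq_sqrt (by positivity)
  have hp1 : 0 < Real.sqrt (μ ^ 2 + 2 * σ ^ 2 * δ) := Real.sqrt_pos.mpr (by positivity)
  have hp3 : 0 < Real.sqrt ((μ - M) ^ 2 + 2 * σ ^ 2 * δ) := Real.sqrt_pos.mpr (by positivity)
  generalize Real.sqrt (μ ^ 2 + 2 * σ ^ 2 * δ) = s1 at *
  generalize Real.sqrt ((μ - M) ^ 2 + 2 * σ ^ 2 * δ) = s3 at *
  have hσ2 : 0 < σ ^ 2 := by positivity
  have hσδ : 0 < σ ^ 2 * δ := by positivity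
  have e1 : μ + σ ^ 2 * θ1 = s1 := by rw [hθ1]; field_simp; ring
  have e3 : μ - M - σ ^ 2 * θ3 = -s3 := by rw [hθ3]; field_simp; ring
  have hs1μ : μ < s1 := lt_of_pow_lt_pow_left₀ 2 hp1.le (by linarith)
  have habs3 := abs_lt_of_sq_lt_sq (show (μ - M) ^ 2 < s3 ^ 2 by linarith) hp3.le
  rw [abs_lt] at habs3
  have t1 : 0 < θ1 := by rw [hθ1]; apply div_pos <;> linarith
  have t2 : 0 < θ2 := by rw [hθ2]; apply div_pos <;> linarith
  have t3 : 0 < θ3 := by rw [hθ3]; apply div_pos <;> linarith [habs3.1]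
  rw [e1, e3] at hhigh
  rw [e3] at hlow
  simp only [e1, e3] at hG
  have q1 : θ1 * (s1 + μ) = 2 * δ := by
    rw [hθ1]; field_simp; nlinarith
  have q3 : θ3 * (s3 - (μ - M)) = 2 * δ := by
    rw [hθ3]; field_simp; nlinarith
  clear hθ1 hθ2 hθ3
  have D1 : 0 < 1 / (-s3) + θ3 / δ := by
    have : 1 / (-s3) + θ3 / δ = (θ3 * s3 - δ) / (s3 * δ) := by field_simp; ring
    rw [this]
    apply div_pos _ (by positivity)
    nlinarith [mul_pos t3 (show 0 < s3 + (μ - M) by linarith [habs3.1])]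
  have D2 : 0 < θ1 / δ - 1 / s1 := by
    have : θ1 / δ - 1 / s1 = (θ1 * s1 - δ) / (s1 * δ) := by field_simp
    rw [this]
    apply div_pos _ (by positivity)
    nlinarith [mul_pos t1 (show 0 < s1 - μ by linarith)]
  rw [div_lt_iff₀ D1] at hlow
  rw [lt_div_iff₀ (by positivity)] at hhigh
  obtain ⟨x0, bx0⟩ := barrier_aux_exp (θ1 + θ2) (by positivity)
  set k1 := lam * (M * θ3 / δ) / s1 with hk1
  set k3 := lam * (M / δ) / (-s3) with hk3
  set A1 := θ1 * θ3 * (1 + lam / δ) * (M / δ) - (θ1 + θ3) with hA1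
  set A2 := θ2 * θ3 * (1 + lam / δ) * (M / δ) - (θ2 - θ3) with hA2
  obtain ⟨b, hb, hPb⟩ := barrier_aux_ivt
    (fun b => -θ3 * k1 + θ3 * k1 * Real.exp (-((θ1 + θ2) * b)) ^ 2
      + k3 * (θ1 + θ2 * Real.exp (-((θ1 + θ2) * b))) ^ 2
      + 2 * (θ1 + θ2) * θ3 * k1 * (b * Real.exp (-((θ1 + θ2) * b)))
      + (A1 + A2 * Real.exp (-((θ1 + θ2) * b)))
        * (θ1 + θ3 + (θ2 - θ3) * Real.exp (-((θ1 + θ2) * b))))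
    (by fun_prop)
    (by
      have h : 0 < (lam * (1 / (-s3) + θ3 / δ) - (δ / M - θ3)) * (M / δ) * (θ1 + θ2) ^ 2 := by
        have : 0 < lam * (1 / (-s3) + θ3 / δ) - (δ / M - θ3) := by linarith
        positivity
      convert h using 1
      simp only [mul_zero, neg_zero, Real.exp_zero, zero_mul, hk3, hA1, hA2]
      field_simp
      ring)
    (-θ3 * k1 + θ3 * k1 * 0 ^ 2 + k3 * (θ1 + θ2 * 0) ^ 2 + 2 * (θ1 + θ2) * θ3 * k1 * 0
      + (A1 + A2 * 0) * (θ1 + θ3 + (θ2 - θ3) * 0))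
    (by
      have h : (lam * (θ1 ^ 2 * (1 / (-s3) + θ3 / δ) + θ3 ^ 2 * (θ1 / δ - 1 / s1))
          - (θ1 + θ3) * ((δ / M) * (θ1 + θ3) - θ1 * θ3)) * (M / δ) < 0 :=
        mul_neg_of_neg_of_pos (by linarith) (by positivity)
      convert h using 1
      simp only [hk1, hk3, hA1]
      field_simp
      ring)
    ((((tendsto_const_nhds.add ((x0.pow 2).const_mul _)).add
      ((((x0.const_mul _).const_add _).pow 2).const_mul _)).add (bx0.const_mul _)).add
      (((x0.const_mul _).const_add _).mul ((x0.const_mul _).const_add _)))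
  refine ⟨b, hb, ?_⟩
  rw [hG]
  have x1 : Real.exp (2 * θ1 * b) = Real.exp (θ1 * b) ^ 2 := by
    rw [← Real.exp_nat_mul]; congr 1; push_cast; ring
  have x2 : Real.exp (-2 * θ2 * b) = Real.exp (-θ2 * b) ^ 2 := by
    rw [← Real.exp_nat_mul]; congr 1; push_cast; ring
  have x3 : Real.exp ((θ1 - θ3) * b) = Real.exp (θ1 * b) / Real.exp (θ3 * b) := by
    rw [← Real.exp_sub]; congr 1; ring
  have x4 : Real.exp (-(θ2 + θ3) * b) = Real.exp (-θ2 * b) / Real.exp (θ3 * b) := by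
    rw [← Real.exp_sub]; congr 1; ring
  have x5 : Real.exp ((θ1 - θ2) * b) = Real.exp (θ1 * b) * Real.exp (-θ2 * b) := by
    rw [← Real.exp_add]; congr 1; ring
  have x6 : Real.exp (-((θ1 + θ2) * b)) = Real.exp (-θ2 * b) / Real.exp (θ1 * b) := by
    rw [← Real.exp_sub]; congr 1; ring
  have hEF : Real.exp (-θ2 * b) < Real.exp (θ1 * b) := by
    apply Real.exp_lt_exp.mpr
    have u1 := mul_pos t1 hb
    have u2 := mul_pos t2 hb
    rw [neg_mul]
    exact lt_trans (neg_lt_zero.mpr u2) u1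
  simp only [x6] at hPb
  rw [x1, x2, x3, x4, x5]
  have pE := Real.exp_pos (θ1 * b)
  have pF := Real.exp_pos (-θ2 * b)
  have pT := Real.exp_pos (θ3 * b)
  generalize Real.exp (θ1 * b) = E at *
  generalize Real.exp (-θ2 * b) = F at *
  generalize Real.exp (θ3 * b) = T at *
  have hDen : 0 < (θ1 + θ3) * E + (θ2 - θ3) * F := by
    nlinarith [mul_pos t3 (sub_pos.mpr hEF), mul_pos t1 pE, mul_pos t2 pF]
  have hDen' : (θ1 + θ3) * E + (θ2 - θ3) * F ≠ 0 := hDen.ne'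
  clear_value A1 A2
  have key := barrier_aux_alg lam M δ s1 s3 θ1 θ2 θ3 A1 A2 E F T b _ rfl hDen' pE.ne' pT.ne'
  rw [key, ← hk1, ← hk3, hPb]
  simp
end

section
/- The value at zero of G is G(0) = (θ₁+θ₂){[λ/(μ−M−σ²θ₃) + θ₃(1+λ/δ)](M/δ) − 1}; moreover, if λ > (δ/M − θ₃)/(1/(μ−M−σ²θ₃) + θ₃/δ), then G(0) > 0. -/
open Real

theorem pseudo_exponential_G_zero
    (σ μ M δ : ℝ) (hσ : 0 < σ) (hμ : 0 < μ) (hM : 0 < M) (hδ : 0 < δ)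
    (lam : ℝ) (hlam0 : 0 < lam) (hlamδ : lam < δ)
    (θ1 θ2 θ3 : ℝ)
    (hθ1 : θ1 = (-μ + Real.sqrt (μ ^ 2 + 2 * σ ^ 2 * δ)) / σ ^ 2)
    (hθ2 : θ2 = (μ + Real.sqrt (μ ^ 2 + 2 * σ ^ 2 * δ)) / σ ^ 2)
    (hθ3 : θ3 = ((μ - M) + Real.sqrt ((μ - M) ^ 2 + 2 * σ ^ 2 * δ)) / σ ^ 2)
    (G : ℝ → ℝ)
    (hG : ∀ b, G b =
      -θ3 * (lam * ((M * θ3 / δ) *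
          ((θ1 + θ3) * Real.exp (θ1 * b) + (θ2 - θ3) * Real.exp (-θ2 * b))⁻¹) / (μ + σ ^ 2 * θ1))
        * Real.exp (2 * θ1 * b)
      + θ3 * (lam * ((M * θ3 / δ) *
          ((θ1 + θ3) * Real.exp (θ1 * b) + (θ2 - θ3) * Real.exp (-θ2 * b))⁻¹) / (μ + σ ^ 2 * θ1))
        * Real.exp (-2 * θ2 * b)
      + θ1 * (lam * ((M / δ) * Real.exp (θ3 * b) *
          (θ1 * Real.exp (θ1 * b) + θ2 * Real.exp (-θ2 * b)) /
          ((θ1 + θ3) * Real.exp (θ1 * b) + (θ2 - θ3) * Real.exp (-θ2 * b))) / (μ - M - σ ^ 2 * θ3))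
        * Real.exp ((θ1 - θ3) * b)
      + θ2 * (lam * ((M / δ) * Real.exp (θ3 * b) *
          (θ1 * Real.exp (θ1 * b) + θ2 * Real.exp (-θ2 * b)) /
          ((θ1 + θ3) * Real.exp (θ1 * b) + (θ2 - θ3) * Real.exp (-θ2 * b))) / (μ - M - σ ^ 2 * θ3))
        * Real.exp (-(θ2 + θ3) * b)
      + 2 * (θ1 + θ2) * θ3 * (lam * ((M * θ3 / δ) *
          ((θ1 + θ3) * Real.exp (θ1 * b) + (θ2 - θ3) * Real.exp (-θ2 * b))⁻¹) / (μ + σ ^ 2 * θ1))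
        * b * Real.exp ((θ1 - θ2) * b)
      + (θ1 * θ3 * (1 + lam / δ) * (M / δ) - (θ1 + θ3)) * Real.exp (θ1 * b)
      + (θ2 * θ3 * (1 + lam / δ) * (M / δ) - (θ2 - θ3)) * Real.exp (-θ2 * b))
 :
    G 0 = (θ1 + θ2) *
      ((lam / (μ - M - σ ^ 2 * θ3) + θ3 * (1 + lam / δ)) * (M / δ) - 1) ∧
    ((δ / M - θ3) / (1 / (μ - M - σ ^ 2 * θ3) + θ3 / δ) < lam → 0 < G 0) := by
  have hσ2 : 0 < σ ^ 2 := by positivity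
  have h12 : 0 < θ1 + θ2 := by
    have hS : 0 < Real.sqrt (μ ^ 2 + 2 * σ ^ 2 * δ) := Real.sqrt_pos.mpr (by positivity)
    have : θ1 + θ2 = 2 * Real.sqrt (μ ^ 2 + 2 * σ ^ 2 * δ) / σ ^ 2 := by
      rw [hθ1, hθ2]; ring
    rw [this]; positivity
  have hG0 : G 0 = (θ1 + θ2) *
      ((lam / (μ - M - σ ^ 2 * θ3) + θ3 * (1 + lam / δ)) * (M / δ) - 1) := by
    have hs : θ1 + θ3 + (θ2 - θ3) = θ1 + θ2 := by ring
    rw [hG 0]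
    simp only [mul_zero, Real.exp_zero, mul_one, zero_mul, add_zero, hs]
    rw [mul_div_assoc (M / δ), div_self h12.ne']
    ring
  refine ⟨hG0, fun h => ?_⟩
  rw [hG0]
  apply mul_pos h12
  have hK : 0 < 1 / (μ - M - σ ^ 2 * θ3) + θ3 / δ := by
    have hpos : 0 < (μ - M) ^ 2 + 2 * σ ^ 2 * δ := by positivity
    have hS := Real.sqrt_pos.mpr hpos
    have hsq := Real.sq_sqrt hpos.le
    generalize Real.sqrt ((μ - M) ^ 2 + 2 * σ ^ 2 * δ) = S at *
    have hσδ : 0 < σ ^ 2 * δ := by positivity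
    have hne : 0 < (μ - M + S) ^ 2 := by
      refine sq_pos_of_ne_zero (fun h0 => ?_)
      have : S = -(μ - M) := by linarith
      rw [this] at hsq
      nlinarith
    have hD : μ - M - σ ^ 2 * θ3 = -S := by
      rw [hθ3]; field_simp; ring
    have : 1 / (μ - M - σ ^ 2 * θ3) + θ3 / δ = (μ - M + S) ^ 2 / (2 * (σ ^ 2 * δ * S)) := by
      rw [hD, hθ3]; field_simp; linear_combination hsq
    rw [this]; positivity
  rw [div_lt_iff₀ hK] at h
  have h2 := mul_lt_mul_of_pos_right h (div_pos hM hδ)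
  have e : (δ / M - θ3) * (M / δ) = 1 - θ3 * (M / δ) := by field_simp
  rw [e] at h2
  have e2 : (lam / (μ - M - σ ^ 2 * θ3) + θ3 * (1 + lam / δ)) * (M / δ)
      = lam * (1 / (μ - M - σ ^ 2 * θ3) + θ3 / δ) * (M / δ) + θ3 * (M / δ) := by ring
  rw [e2]; linarith
end

section
/- Define A = λ(M/δ)[θ₃²(θ₁/δ − 1/(μ+σ²θ₁)) + θ₁²(1/(μ−M−σ²θ₃) + θ₃/δ)] + θ₁θ₃(θ₁+θ₃)(M/δ − 1/θ₃ − 1/θ₁). If λ < (θ₁+θ₃)[(δ/M)(θ₁+θ₃) − θ₁θ₃] / [θ₁²(1/(μ−M−σ²θ₃) + θ₃/δ) + θ₃²(θ₁/δ − 1/(μ+σ²θ₁))], then A < 0, and consequently G(b) → −∞ as b → ∞. -/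
open Real Filter

theorem pseudo_exponential_G_tendsto_bot
    (σ μ M δ : ℝ) (hσ : 0 < σ) (hμ : 0 < μ) (hM : 0 < M) (hδ : 0 < δ)
    (lam : ℝ) (hlam0 : 0 < lam) (hlamδ : lam < δ)
    (θ1 θ2 θ3 : ℝ)
    (hθ1 : θ1 = (-μ + Real.sqrt (μ ^ 2 + 2 * σ ^ 2 * δ)) / σ ^ 2)
    (hθ2 : θ2 = (μ + Real.sqrt (μ ^ 2 + 2 * σ ^ 2 * δ)) / σ ^ 2)
    (hθ3 : θ3 = ((μ - M) + Real.sqrt ((μ - M) ^ 2 + 2 * σ ^ 2 * δ)) / σ ^ 2)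
    (G : ℝ → ℝ)
    (hG : ∀ b, G b =
      -θ3 * (lam * ((M * θ3 / δ) *
          ((θ1 + θ3) * Real.exp (θ1 * b) + (θ2 - θ3) * Real.exp (-θ2 * b))⁻¹) / (μ + σ ^ 2 * θ1))
        * Real.exp (2 * θ1 * b)
      + θ3 * (lam * ((M * θ3 / δ) *
          ((θ1 + θ3) * Real.exp (θ1 * b) + (θ2 - θ3) * Real.exp (-θ2 * b))⁻¹) / (μ + σ ^ 2 * θ1))
        * Real.exp (-2 * θ2 * b)
      + θ1 * (lam * ((M / δ) * Real.exp (θ3 * b) *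
          (θ1 * Real.exp (θ1 * b) + θ2 * Real.exp (-θ2 * b)) /
          ((θ1 + θ3) * Real.exp (θ1 * b) + (θ2 - θ3) * Real.exp (-θ2 * b))) / (μ - M - σ ^ 2 * θ3))
        * Real.exp ((θ1 - θ3) * b)
      + θ2 * (lam * ((M / δ) * Real.exp (θ3 * b) *
          (θ1 * Real.exp (θ1 * b) + θ2 * Real.exp (-θ2 * b)) /
          ((θ1 + θ3) * Real.exp (θ1 * b) + (θ2 - θ3) * Real.exp (-θ2 * b))) / (μ - M - σ ^ 2 * θ3))
        * Real.exp (-(θ2 + θ3) * b)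
      + 2 * (θ1 + θ2) * θ3 * (lam * ((M * θ3 / δ) *
          ((θ1 + θ3) * Real.exp (θ1 * b) + (θ2 - θ3) * Real.exp (-θ2 * b))⁻¹) / (μ + σ ^ 2 * θ1))
        * b * Real.exp ((θ1 - θ2) * b)
      + (θ1 * θ3 * (1 + lam / δ) * (M / δ) - (θ1 + θ3)) * Real.exp (θ1 * b)
      + (θ2 * θ3 * (1 + lam / δ) * (M / δ) - (θ2 - θ3)) * Real.exp (-θ2 * b))
    (A : ℝ)
    (hA : A = lam * (M / δ) *
        (θ3 ^ 2 * (θ1 / δ - 1 / (μ + σ ^ 2 * θ1)) +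
          θ1 ^ 2 * (1 / (μ - M - σ ^ 2 * θ3) + θ3 / δ)) +
      θ1 * θ3 * (θ1 + θ3) * (M / δ - 1 / θ3 - 1 / θ1))
    (hhigh : lam < (θ1 + θ3) * ((δ / M) * (θ1 + θ3) - θ1 * θ3) /
      (θ1 ^ 2 * (1 / (μ - M - σ ^ 2 * θ3) + θ3 / δ) +
        θ3 ^ 2 * (θ1 / δ - 1 / (μ + σ ^ 2 * θ1)))) :
    A < 0 ∧ Tendsto G atTop atBot := by
  have hσ2 : 0 < σ ^ 2 := by positivity
  obtain ⟨s1, hs1⟩ : ∃ s, s = Real.sqrt (μ ^ 2 + 2 * σ ^ 2 * δ) := ⟨_, rfl⟩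
  obtain ⟨s3, hs3⟩ : ∃ s, s = Real.sqrt ((μ - M) ^ 2 + 2 * σ ^ 2 * δ) := ⟨_, rfl⟩
  have hc : 0 < 2 * σ ^ 2 * δ := by positivity
  have q1 : s1 ^ 2 = μ ^ 2 + 2 * σ ^ 2 * δ := by
    rw [hs1]; exact Real.sq_sqrt (by positivity)
  have q3 : s3 ^ 2 = (μ - M) ^ 2 + 2 * σ ^ 2 * δ := by
    rw [hs3]; exact Real.sq_sqrt (by positivity)
  have p1 : 0 < s1 := by rw [hs1]; exact Real.sqrt_pos.2 (by positivity)
  have p3 : 0 < s3 := by rw [hs3]; exact Real.sqrt_pos.2 (by positivity)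
  rw [← hs1] at hθ1 hθ2
  rw [← hs3] at hθ3
  have l1 : μ < s1 := by nlinarith
  have l3 : |μ - M| < s3 := abs_lt_of_sq_lt_sq (by linarith) p3.le
  obtain ⟨l3a, l3b⟩ := abs_lt.1 l3
  have t1 : 0 < θ1 := by rw [hθ1]; apply div_pos <;> linarith
  have t2 : 0 < θ2 := by rw [hθ2]; apply div_pos <;> linarith
  have t3 : 0 < θ3 := by rw [hθ3]; apply div_pos <;> linarith
  have e1 : μ + σ ^ 2 * θ1 = s1 := by rw [hθ1]; field_simp; ring
  have e3 : μ - M - σ ^ 2 * θ3 = -s3 := by rw [hθ3]; field_simp; ring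
  rw [e1, e3] at hA hhigh
  simp only [e1, e3] at hG
  have d1 : 0 < θ1 / δ - 1 / s1 := by
    have : θ1 / δ = 2 / (μ + s1) := by
      rw [hθ1, div_div, div_eq_div_iff (by positivity) (by positivity)]
      linear_combination q1
    rw [this, sub_pos, div_lt_div_iff₀ p1 (by positivity)]
    linarith
  have d3 : 0 < 1 / (-s3) + θ3 / δ := by
    have h0 : 0 < s3 - (μ - M) := by linarith
    have : θ3 / δ = 2 / (s3 - (μ - M)) := by
      rw [hθ3, div_div, div_eq_div_iff (by positivity) h0.ne']
      linear_combination q3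
    have h : 1 / s3 < 2 / (s3 - (μ - M)) := by
      rw [div_lt_div_iff₀ p3 h0]
      linarith
    rw [this, one_div_neg_eq_neg_one_div]
    linarith
  have hA0 : A < 0 := by
    rw [lt_div_iff₀ (by positivity)] at hhigh
    have h := mul_lt_mul_of_pos_left hhigh (div_pos hM hδ)
    have r : M / δ * ((θ1 + θ3) * ((δ / M) * (θ1 + θ3) - θ1 * θ3))
        = - (θ1 * θ3 * (θ1 + θ3) * (M / δ - 1 / θ3 - 1 / θ1)) := by
      field_simp
      ring
    rw [r] at h
    rw [hA]
    linarith
  refine ⟨hA0, ?_⟩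
  have hs : 0 < θ1 + θ2 := by positivity
  have hu : Tendsto (fun b : ℝ => Real.exp (-(θ1 + θ2) * b)) atTop (nhds 0) := by
    refine Real.tendsto_exp_atBot.comp ?_
    exact tendsto_id.const_mul_atTop_of_neg (by linarith)
  have hbu : Tendsto (fun b : ℝ => b * Real.exp (-(θ1 + θ2) * b)) atTop (nhds 0) := by
    have := tendsto_rpow_mul_exp_neg_mul_atTop_nhds_zero 1 (θ1 + θ2) hs
    simpa using this
  have hE : Tendsto (fun b : ℝ => Real.exp (θ1 * b)) atTop atTop :=
    Real.tendsto_exp_atTop.comp (tendsto_id.const_mul_atTop t1)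
  have hK : Tendsto (fun b : ℝ => ((θ1 + θ3) + (θ2 - θ3) * Real.exp (-(θ1 + θ2) * b))⁻¹) atTop
      (nhds ((θ1 + θ3) + (θ2 - θ3) * 0)⁻¹) :=
    ((hu.const_mul (θ2 - θ3)).const_add (θ1 + θ3)).inv₀ (by
      have : 0 < θ1 + θ3 := by positivity
      simpa using this.ne')
  have hN : Tendsto (fun b : ℝ => θ1 + θ2 * Real.exp (-(θ1 + θ2) * b)) atTop
      (nhds (θ1 + θ2 * 0)) := (hu.const_mul θ2).const_add θ1
  have hH := ((((((hK.const_mul (-θ3 * lam * (M * θ3 / δ) / s1)).add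
    ((hK.mul (hu.pow 2)).const_mul (θ3 * lam * (M * θ3 / δ) / s1))).add
    ((hN.mul hK).const_mul (θ1 * lam * (M / δ) / (-s3)))).add
    (((hN.mul hK).mul hu).const_mul (θ2 * lam * (M / δ) / (-s3)))).add
    ((hbu.mul hK).const_mul (2 * (θ1 + θ2) * θ3 * lam * (M * θ3 / δ) / s1))).add_const
    (θ1 * θ3 * (1 + lam / δ) * (M / δ) - (θ1 + θ3))).add
    (hu.const_mul (θ2 * θ3 * (1 + lam / δ) * (M / δ) - (θ2 - θ3)))
  refine (hE.atTop_mul_neg (C := A / (θ1 + θ3)) (div_neg_of_neg_of_pos hA0 (by positivity))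
    (le_trans hH (le_of_eq (congrArg nhds ?_)))).congr ?_
  · rw [hA]
    simp only [mul_zero, add_zero, zero_mul, ne_eq, OfNat.ofNat_ne_zero, not_false_eq_true, zero_pow]
    field_simp
    ring
  · intro b
    rw [hG b]
    have x1 : Real.exp (2 * θ1 * b) = Real.exp (θ1 * b) ^ 2 := by
      rw [← Real.exp_nat_mul]; congr 1; push_cast; ring
    have x2 : Real.exp (-θ2 * b) = Real.exp (θ1 * b) * Real.exp (-(θ1 + θ2) * b) := by
      rw [← Real.exp_add]; congr 1; ring
    have x3 : Real.exp (-2 * θ2 * b) = (Real.exp (θ1 * b) * Real.exp (-(θ1 + θ2) * b)) ^ 2 := by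
      rw [← x2, ← Real.exp_nat_mul]; congr 1; push_cast; ring
    have x4 : Real.exp ((θ1 - θ3) * b) = Real.exp (θ1 * b) * (Real.exp (θ3 * b))⁻¹ := by
      rw [← Real.exp_neg, ← Real.exp_add]; congr 1; ring
    have x5 : Real.exp (-(θ2 + θ3) * b) =
        Real.exp (θ1 * b) * Real.exp (-(θ1 + θ2) * b) * (Real.exp (θ3 * b))⁻¹ := by
      rw [← x2, ← Real.exp_neg, ← Real.exp_add]; congr 1; ring
    have x6 : Real.exp ((θ1 - θ2) * b) =
        Real.exp (θ1 * b) ^ 2 * Real.exp (-(θ1 + θ2) * b) := by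
      rw [pow_two, mul_assoc, ← x2, ← Real.exp_add]; congr 1; ring
    rw [x1, x3, x4, x5, x6, x2]
    have g1 := Real.exp_pos (θ1 * b)
    have g3 := Real.exp_pos (θ3 * b)
    generalize Real.exp (θ1 * b) = E at *
    generalize Real.exp (θ3 * b) = T at *
    generalize Real.exp (-(θ1 + θ2) * b) = u at *
    have k : (θ1 + θ3) * E + (θ2 - θ3) * (E * u) = E * (θ1 + θ3 + (θ2 - θ3) * u) := by ring
    rw [k, div_eq_mul_inv _ (E * _), mul_inv]
    generalize (θ1 + θ3 + (θ2 - θ3) * u)⁻¹ = K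
    field_simp
end

section
/- Define V₄(x) = (1 + λ/δ)(M/δ) + (M/δ)[λx/(μ−M−σ²θ₃) − (1 + λ/δ)] e^{−θ₃ x} for x ≥ 0. Assume δ/M > θ₃ and 0 < λ ≤ (δ/M − θ₃)·[1/(μ−M−σ²θ₃) + θ₃/δ]^{−1}. Then for all x ≥ 0: V₄′(x) > 0, V₄″(x) < 0, and V₄′(x) ≤ 1. -/
open Real

theorem pseudo_exponential_case_i_V4
    (σ μ M δ : ℝ) (hσ : 0 < σ) (hμ : 0 < μ) (hM : 0 < M) (hδ : 0 < δ)
    (lam : ℝ) (hlam0 : 0 < lam) (hlamδ : lam < δ)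
    (θ3 : ℝ)
    (hθ3 : θ3 = ((μ - M) + Real.sqrt ((μ - M) ^ 2 + 2 * σ ^ 2 * δ)) / σ ^ 2)
    (V4 : ℝ → ℝ)
    (hV4 : ∀ x, V4 x = (1 + lam / δ) * (M / δ) +
      (M / δ) * (lam * x / (μ - M - σ ^ 2 * θ3) - (1 + lam / δ)) * Real.exp (-θ3 * x))
    (hδM : θ3 < δ / M)
    (hlam : lam ≤ (δ / M - θ3) * (1 / (μ - M - σ ^ 2 * θ3) + θ3 / δ)⁻¹) :
    ∀ x : ℝ, 0 ≤ x →
      0 < deriv V4 x ∧ deriv (deriv V4) x < 0 ∧ deriv V4 x ≤ 1 := by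
  have hσ2 : 0 < σ ^ 2 := by positivity
  have hR : 0 < (μ - M) ^ 2 + 2 * σ ^ 2 * δ := by positivity
  obtain ⟨S, hS⟩ : ∃ S, S = Real.sqrt ((μ - M) ^ 2 + 2 * σ ^ 2 * δ) := ⟨_, rfl⟩
  have hSpos : 0 < S := hS ▸ Real.sqrt_pos.mpr hR
  have hSsq : S ^ 2 = (μ - M) ^ 2 + 2 * σ ^ 2 * δ := by rw [hS]; exact Real.sq_sqrt hR.le
  rw [← hS] at hθ3
  have hθS : σ ^ 2 * θ3 = (μ - M) + S := by rw [hθ3]; field_simp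
  have hD : μ - M - σ ^ 2 * θ3 = -S := by linarith
  rw [hD] at hlam
  simp only [hD] at hV4
  have hθpos : 0 < θ3 := by
    have h1 : 0 < (μ - M) + S := by
      have : |μ - M| < S := abs_lt_of_sq_lt_sq (by rw [hSsq]; nlinarith [mul_pos hσ2 hδ]) hSpos.le
      linarith [neg_abs_le (μ - M)]
    rw [hθ3]; positivity
  have hkey : δ < θ3 * S := by
    have h2 : σ ^ 2 * (θ3 * S - δ) = σ ^ 2 * (σ ^ 2 * θ3 ^ 2 / 2) := by
      have e : S = σ ^ 2 * θ3 - (μ - M) := by linarith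
      rw [e] at hSsq ⊢
      nlinarith
    have h3 := mul_left_cancel₀ hσ2.ne' h2
    have : 0 < σ ^ 2 * θ3 ^ 2 / 2 := by positivity
    linarith
  have hinv : 1 / S < θ3 / δ := by
    rw [div_lt_div_iff₀ hSpos hδ]; linarith
  obtain ⟨p, hp⟩ : ∃ p, p = lam / S := ⟨_, rfl⟩
  have hppos : 0 < p := by rw [hp]; positivity
  obtain ⟨a, ha⟩ : ∃ a, a = θ3 * (1 + lam / δ) - p := ⟨_, rfl⟩
  have hpθ : p < lam * (θ3 / δ) := by
    have := mul_lt_mul_of_pos_left hinv hlam0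
    rw [hp]; calc lam / S = lam * (1 / S) := by ring
      _ < _ := this
  have hθ1 : lam * (θ3 / δ) < θ3 := by
    rw [← mul_div_assoc, div_lt_iff₀ hδ]; nlinarith
  have hap : p < a := by
    have : θ3 * (1 + lam / δ) = θ3 + lam * (θ3 / δ) := by ring
    linarith
  have hA : 0 < M / δ := by positivity
  have hA1 : M / δ * a ≤ 1 := by
    have hq : 0 < 1 / (-S) + θ3 / δ := by
      rw [one_div, inv_neg, ← one_div]; linarith
    rw [← div_eq_mul_inv, le_div_iff₀ hq] at hlam
    have : a ≤ δ / M := by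
      have : a = lam * (1 / (-S) + θ3 / δ) + θ3 := by
        rw [ha, hp, one_div, inv_neg]; ring
      linarith
    calc M / δ * a ≤ M / δ * (δ / M) := by gcongr
      _ = 1 := by field_simp
  have hE : ∀ x : ℝ, HasDerivAt (fun x => Real.exp (-θ3 * x)) (Real.exp (-θ3 * x) * (-θ3)) x := by
    intro x
    simpa using ((hasDerivAt_id x).const_mul (-θ3)).exp
  have hd1 : ∀ x, deriv V4 x = M / δ * (a + θ3 * p * x) * Real.exp (-θ3 * x) := by
    intro x
    have hV : V4 = fun x => (1 + lam / δ) * (M / δ) +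
        (M / δ * (-p * x - (1 + lam / δ))) * Real.exp (-θ3 * x) := by
      funext y; rw [hV4, hp, div_neg]; ring
    rw [hV]
    have h := (((((hasDerivAt_id x).const_mul (-p)).sub_const (1 + lam / δ)).const_mul
      (M / δ)).mul (hE x)).const_add ((1 + lam / δ) * (M / δ))
    refine (h.congr_deriv ?_).deriv
    simp only [id, ha]; ring
  have hd2 : ∀ x, deriv (deriv V4) x
      = M / δ * θ3 * (p - a - θ3 * p * x) * Real.exp (-θ3 * x) := by
    intro x
    rw [funext hd1]
    have h := ((((hasDerivAt_id x).const_mul (θ3 * p)).const_add a).const_mul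
      (M / δ)).mul (hE x)
    refine (h.congr_deriv ?_).deriv
    simp only [id]; ring
  intro x hx
  have hpx : 0 ≤ θ3 * p * x := by positivity
  have hapos : 0 < a := hppos.trans hap
  rw [hd2, hd1]
  refine ⟨by positivity, ?_, ?_⟩
  · apply mul_neg_of_neg_of_pos _ (Real.exp_pos _)
    apply mul_neg_of_pos_of_neg (by positivity)
    linarith
  · have h1 : a + θ3 * p * x ≤ a * Real.exp (θ3 * x) := by
      have h2 := Real.add_one_le_exp (θ3 * x)
      have h3 := mul_le_mul_of_nonneg_left h2 hapos.le
      have h4 := mul_le_mul_of_nonneg_right hap.le (mul_nonneg hθpos.le hx)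
      linarith
    calc M / δ * (a + θ3 * p * x) * Real.exp (-θ3 * x)
        ≤ M / δ * (a * Real.exp (θ3 * x)) * Real.exp (-θ3 * x) := by gcongr
      _ = M / δ * a * (Real.exp (θ3 * x) * Real.exp (-θ3 * x)) := by ring
      _ = M / δ * a := by rw [← Real.exp_add]; simp
      _ ≤ 1 := hA1
end

section
/- Define V₃(x) = (M/δ)(1 − e^{−θ₃ x}) and V₄(x) = (1 + λ/δ)(M/δ) + (M/δ)[λx/(μ−M−σ²θ₃) − (1 + λ/δ)] e^{−θ₃ x} for x ≥ 0. Then V₃(0) = 0, V₄(0) = 0, and the coupled ordinary differential equations hold for all x ≥ 0: (1/2)σ²V₃″(x) + (μ−M)V₃′(x) − δV₃(x) + M = 0 and (1/2)σ²V₄″(x) + (μ−M)V₄′(x) − δV₄(x) + λV₃(x) + M = 0. -/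
open Real

theorem deriv_aux (a b c k : ℝ) :
    deriv (fun x : ℝ => a + (b * x + c) * Real.exp (k * x)) =
      fun x => 0 + ((k * b) * x + (b + k * c)) * Real.exp (k * x) := by
  funext x
  have h1 : HasDerivAt (fun x : ℝ => b * x + c) (b * 1) x :=
    ((hasDerivAt_id x).const_mul b).add_const c
  have h2 : HasDerivAt (fun x : ℝ => Real.exp (k * x)) (Real.exp (k * x) * (k * 1)) x :=
    ((hasDerivAt_id x).const_mul k).exp
  have h3 := (h1.mul h2).const_add a
  refine h3.deriv.trans ?_
  ring

theorem pseudo_exponential_case_i_ODEs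
    (σ μ M δ : ℝ) (hσ : 0 < σ) (hμ : 0 < μ) (hM : 0 < M) (hδ : 0 < δ)
    (lam : ℝ) (hlam0 : 0 < lam) (hlamδ : lam < δ)
    (θ3 : ℝ)
    (hθ3 : θ3 = ((μ - M) + Real.sqrt ((μ - M) ^ 2 + 2 * σ ^ 2 * δ)) / σ ^ 2)
    (V3 V4 : ℝ → ℝ)
    (hV3 : ∀ x, V3 x = (M / δ) * (1 - Real.exp (-θ3 * x)))
    (hV4 : ∀ x, V4 x = (1 + lam / δ) * (M / δ) +
      (M / δ) * (lam * x / (μ - M - σ ^ 2 * θ3) - (1 + lam / δ)) * Real.exp (-θ3 * x)) :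
    V3 0 = 0 ∧ V4 0 = 0 ∧
    (∀ x : ℝ, 0 ≤ x →
      (1 / 2) * σ ^ 2 * deriv (deriv V3) x + (μ - M) * deriv V3 x - δ * V3 x + M = 0 ∧
      (1 / 2) * σ ^ 2 * deriv (deriv V4) x + (μ - M) * deriv V4 x - δ * V4 x
        + lam * V3 x + M = 0) := by
  have hs : 0 < (μ - M) ^ 2 + 2 * σ ^ 2 * δ := by positivity
  have hsq := Real.sq_sqrt hs.le
  have hpos := Real.sqrt_pos.mpr hs
  have hθ : σ ^ 2 * θ3 = (μ - M) + Real.sqrt ((μ - M) ^ 2 + 2 * σ ^ 2 * δ) := by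
    rw [hθ3]; field_simp
  have hD : μ - M - σ ^ 2 * θ3 ≠ 0 := by rw [hθ]; linarith
  have hquad : (1 / 2) * σ ^ 2 * θ3 ^ 2 - (μ - M) * θ3 - δ = 0 := by
    have h : Real.sqrt ((μ - M) ^ 2 + 2 * σ ^ 2 * δ) = σ ^ 2 * θ3 - (μ - M) := by linarith
    rw [h] at hsq
    have h2 : σ ^ 2 * ((1 / 2) * σ ^ 2 * θ3 ^ 2 - (μ - M) * θ3 - δ) = 0 := by
      linear_combination (1 / 2) * hsq
    exact (mul_eq_zero.mp h2).resolve_left (by positivity)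
  obtain ⟨m, hm⟩ : ∃ m, m = M / δ := ⟨_, rfl⟩
  obtain ⟨l, hl⟩ : ∃ l, l = lam / δ := ⟨_, rfl⟩
  obtain ⟨B, hB⟩ : ∃ B, B = m * lam / (μ - M - σ ^ 2 * θ3) := ⟨_, rfl⟩
  have hm' : m * δ = M := by rw [hm]; field_simp
  have hl' : l * δ = lam := by rw [hl]; field_simp
  have hB' : B * (μ - M - σ ^ 2 * θ3) = m * lam := by rw [hB]; field_simp
  have e3 : V3 = fun x => m + (0 * x + (-m)) * Real.exp (-θ3 * x) := by
    funext x; rw [hV3, ← hm]; ring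
  have e4 : V4 = fun x => (1 + l) * m + (B * x + (-(m * (1 + l)))) * Real.exp (-θ3 * x) := by
    funext x; rw [hV4, ← hm, ← hl, hB]; ring
  refine ⟨?_, ?_, fun x _ => ⟨?_, ?_⟩⟩
  · rw [e3]; simp
  · rw [e4]; simp; ring
  · rw [e3, deriv_aux, deriv_aux]
    linear_combination (-m * Real.exp (-θ3 * x)) * hquad - hm'
  · rw [e4, e3, deriv_aux, deriv_aux]
    linear_combination ((B * x - m * (1 + l)) * Real.exp (-θ3 * x)) * hquad
      + Real.exp (-θ3 * x) * hB' - hm' - m * hl'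
end

section
/- Fix b ≥ 0, let d = d(b), B₃ = λd/(μ−M−σ²θ₃) and D₃ = (1/θ₃)(B₃ − e^{θ₃ b}) − B₃ b, and define V₄(x) = (1 + λ/δ)(M/δ) + (D₃ + B₃ x) e^{−θ₃ x} for x ≥ b. Then B₃ < 0 and for all x ≥ b: V₄′(x) ≥ e^{θ₃(b−x)} > 0. If in addition λ ≤ δ²/(Mθ₃), then V₄″(x) < 0 for all x ≥ b. -/
open Real

theorem pseudo_exponential_case_ii_above_barrier
    (σ μ M δ : ℝ) (hσ : 0 < σ) (hμ : 0 < μ) (hM : 0 < M) (hδ : 0 < δ)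
    (lam : ℝ) (hlam0 : 0 < lam) (hlamδ : lam < δ)
    (θ1 θ2 θ3 : ℝ)
    (hθ1 : θ1 = (-μ + Real.sqrt (μ ^ 2 + 2 * σ ^ 2 * δ)) / σ ^ 2)
    (hθ2 : θ2 = (μ + Real.sqrt (μ ^ 2 + 2 * σ ^ 2 * δ)) / σ ^ 2)
    (hθ3 : θ3 = ((μ - M) + Real.sqrt ((μ - M) ^ 2 + 2 * σ ^ 2 * δ)) / σ ^ 2)
    (b : ℝ) (hb : 0 ≤ b)
    (d B3 D3 : ℝ)
    (hd : d = (M / δ) * Real.exp (θ3 * b) *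
      (θ1 * Real.exp (θ1 * b) + θ2 * Real.exp (-θ2 * b)) /
      ((θ1 + θ3) * Real.exp (θ1 * b) + (θ2 - θ3) * Real.exp (-θ2 * b)))
    (hB3 : B3 = lam * d / (μ - M - σ ^ 2 * θ3))
    (hD3 : D3 = (1 / θ3) * (B3 - Real.exp (θ3 * b)) - B3 * b)
    (V4 : ℝ → ℝ)
    (hV4 : ∀ x, V4 x = (1 + lam / δ) * (M / δ) + (D3 + B3 * x) * Real.exp (-θ3 * x)) :
    B3 < 0 ∧
    (∀ x : ℝ, b ≤ x → Real.exp (θ3 * (b - x)) ≤ deriv V4 x ∧ 0 < Real.exp (θ3 * (b - x))) ∧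
    (lam ≤ δ ^ 2 / (M * θ3) → ∀ x : ℝ, b ≤ x → deriv (deriv V4) x < 0) := by
  have hs2 : 0 < σ ^ 2 := by positivity
  obtain ⟨S, hS⟩ : ∃ S, S = Real.sqrt (μ ^ 2 + 2 * σ ^ 2 * δ) := ⟨_, rfl⟩
  obtain ⟨R, hR⟩ : ∃ R, R = Real.sqrt ((μ - M) ^ 2 + 2 * σ ^ 2 * δ) := ⟨_, rfl⟩
  rw [← hS] at hθ1 hθ2
  rw [← hR] at hθ3
  have hpos : 0 < 2 * σ ^ 2 * δ := by positivity
  have hS1 : μ < S := by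
    rw [hS]; apply Real.lt_sqrt_of_sq_lt; linarith
  have hRabs : |μ - M| < R := by
    rw [hR]; apply Real.lt_sqrt_of_sq_lt; rw [sq_abs]; linarith
  have hRsq : R ^ 2 = (μ - M) ^ 2 + 2 * σ ^ 2 * δ := by
    rw [hR]; exact Real.sq_sqrt (by positivity)
  have hR1 := (abs_lt.mp hRabs).1
  have hR2 := (abs_lt.mp hRabs).2
  have hR0 : 0 < R := lt_of_le_of_lt (abs_nonneg _) hRabs
  have t1 : 0 < θ1 := by rw [hθ1]; apply div_pos <;> linarith
  have t2 : 0 < θ2 := by rw [hθ2]; apply div_pos <;> linarith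
  have t3 : 0 < θ3 := by rw [hθ3]; apply div_pos <;> linarith
  have hst : σ ^ 2 * θ3 = (μ - M) + R := by rw [hθ3]; field_simp
  have hroot : δ = θ3 * ((R - (μ - M)) / 2) := by
    have : σ ^ 2 * δ = σ ^ 2 * (θ3 * ((R - (μ - M)) / 2)) := by
      rw [← mul_assoc, hst]; linarith [hRsq, show (μ - M + R) * ((R - (μ - M)) / 2) = (R ^ 2 - (μ - M) ^ 2) / 2 by ring]
    exact mul_left_cancel₀ hs2.ne' this
  have hden : μ - M - σ ^ 2 * θ3 = -R := by rw [hst]; ring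
  rw [hden] at hB3
  have hE : 0 < Real.exp (θ1 * b) := Real.exp_pos _
  have hF : 0 < Real.exp (-θ2 * b) := Real.exp_pos _
  have hG : 0 < Real.exp (θ3 * b) := Real.exp_pos _
  have hFE : Real.exp (-θ2 * b) ≤ Real.exp (θ1 * b) := by
    apply Real.exp_le_exp.mpr
    linarith [mul_nonneg t1.le hb, mul_nonneg t2.le hb]
  generalize Real.exp (θ1 * b) = E at *
  generalize Real.exp (-θ2 * b) = F at *
  have hN : 0 < θ1 * E + θ2 * F := by positivity
  have hND : θ1 * E + θ2 * F ≤ (θ1 + θ3) * E + (θ2 - θ3) * F := by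
    linarith [mul_nonneg t3.le (sub_nonneg.mpr hFE)]
  have hDn : 0 < (θ1 + θ3) * E + (θ2 - θ3) * F := lt_of_lt_of_le hN hND
  have hd0 : 0 < d := by rw [hd]; positivity
  have hd1 : d ≤ (M / δ) * Real.exp (θ3 * b) := by
    rw [hd, div_le_iff₀ hDn]
    exact mul_le_mul_of_nonneg_left hND (by positivity)
  have hBneg : B3 < 0 := by
    rw [hB3]; exact div_neg_of_pos_of_neg (by positivity) (by linarith)
  have hBR : B3 * R = -(lam * d) := by
    rw [hB3]; field_simp
  have hDt : B3 - θ3 * D3 = Real.exp (θ3 * b) + θ3 * B3 * b := by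
    rw [hD3]; field_simp; ring
  have hexp : ∀ x : ℝ, HasDerivAt (fun x : ℝ => Real.exp (-θ3 * x)) (Real.exp (-θ3 * x) * -θ3) x := by
    intro x
    simpa using ((hasDerivAt_id x).const_mul (-θ3)).exp
  have hd1' : ∀ x, deriv V4 x = (Real.exp (θ3 * b) - θ3 * B3 * (x - b)) * Real.exp (-θ3 * x) := by
    intro x
    have hV : V4 = fun x => (1 + lam / δ) * (M / δ) + (D3 + B3 * x) * Real.exp (-θ3 * x) := funext hV4
    have h := (((((hasDerivAt_id x).const_mul B3).const_add D3).mul (hexp x)).const_add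
      ((1 + lam / δ) * (M / δ)))
    rw [hV]
    refine (HasDerivAt.deriv h).trans ?_
    simp only [id]
    linear_combination Real.exp (-θ3 * x) * hDt
  have hd2' : ∀ x, deriv (deriv V4) x =
      -(θ3 * ((B3 + Real.exp (θ3 * b) - θ3 * B3 * (x - b)) * Real.exp (-θ3 * x))) := by
    intro x
    rw [funext hd1']
    have h := ((((hasDerivAt_id x).sub_const b).const_mul (θ3 * B3)).const_sub
      (Real.exp (θ3 * b))).mul (hexp x)
    refine (HasDerivAt.deriv h).trans ?_
    simp only [id]
    ring
  have hnn : ∀ x, b ≤ x → 0 ≤ -(θ3 * B3 * (x - b)) := by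
    intro x hx
    linarith [mul_nonneg (mul_nonneg t3.le (neg_pos.mpr hBneg).le) (sub_nonneg.mpr hx)]
  refine ⟨hBneg, fun x hx => ⟨?_, Real.exp_pos _⟩, fun hl x hx => ?_⟩
  · rw [hd1', show θ3 * (b - x) = θ3 * b + -θ3 * x by ring, Real.exp_add]
    apply mul_le_mul_of_nonneg_right _ (Real.exp_pos _).le
    linarith [hnn x hx]
  · rw [hd2']
    have hlM : lam * (M / δ) < R := by
      have h1 : lam * (M * θ3) ≤ δ ^ 2 := (le_div_iff₀ (by positivity)).mp hl
      have h2 : δ < θ3 * R := by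
        linarith [mul_pos t3 (show 0 < R + (μ - M) by linarith)]
      rw [← mul_div_assoc, div_lt_iff₀ hδ]
      have h3 : θ3 * (lam * M) < θ3 * (R * δ) := by
        linarith [mul_lt_mul_of_pos_right h2 hδ]
      exact lt_of_mul_lt_mul_left h3 t3.le
    have hkey : 0 < B3 + Real.exp (θ3 * b) := by
      have h1 := mul_le_mul_of_nonneg_left hd1 hlam0.le
      have h2 := mul_lt_mul_of_pos_right hlM hG
      have h3 : 0 < (B3 + Real.exp (θ3 * b)) * R := by
        rw [add_mul, hBR]; linarith
      exact pos_of_mul_pos_left h3 hR0.le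
    have h4 : 0 < B3 + Real.exp (θ3 * b) - θ3 * B3 * (x - b) := by linarith [hnn x hx]
    have := mul_pos t3 (mul_pos h4 (Real.exp_pos (-θ3 * x)))
    linarith
end

section
/- Fix b ≥ 0, let C = C(b), B₁ = λC/(μ+σ²θ₁) and Ĉ = [1 + (θ₁b + 1)B₁e^{θ₁b} − (θ₂b − 1)B₁e^{−θ₂b}] / (θ₁e^{θ₁b} + θ₂e^{−θ₂b}). If 0 < λ ≤ min{ (θ₁+θ₂)/(θ₁+3θ₂) · δ²/(Mθ₃), (θ₁+θ₃)(θ₁+θ₂)/(2θ₁(θ₁+2θ₂)) · δ²/(Mθ₃) }, then θ₁Ĉ − 3B₁ − θ₁B₁b > 0. -/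
open Real

theorem lemma_b1
    (σ μ M δ : ℝ) (hσ : 0 < σ) (hμ : 0 < μ) (hM : 0 < M) (hδ : 0 < δ)
    (lam : ℝ) (hlam0 : 0 < lam) (hlamδ : lam < δ)
    (θ1 θ2 θ3 : ℝ)
    (hθ1 : θ1 = (-μ + Real.sqrt (μ ^ 2 + 2 * σ ^ 2 * δ)) / σ ^ 2)
    (hθ2 : θ2 = (μ + Real.sqrt (μ ^ 2 + 2 * σ ^ 2 * δ)) / σ ^ 2)
    (hθ3 : θ3 = ((μ - M) + Real.sqrt ((μ - M) ^ 2 + 2 * σ ^ 2 * δ)) / σ ^ 2)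
    (b : ℝ) (hb : 0 ≤ b)
    (C B1 Chat : ℝ)
    (hC : C = (M * θ3 / δ) *
      ((θ1 + θ3) * Real.exp (θ1 * b) + (θ2 - θ3) * Real.exp (-θ2 * b))⁻¹)
    (hB1 : B1 = lam * C / (μ + σ ^ 2 * θ1))
    (hChat : Chat = (1 + (θ1 * b + 1) * B1 * Real.exp (θ1 * b)
        - (θ2 * b - 1) * B1 * Real.exp (-θ2 * b)) /
      (θ1 * Real.exp (θ1 * b) + θ2 * Real.exp (-θ2 * b)))
    (hlam : lam ≤ min ((θ1 + θ2) / (θ1 + 3 * θ2) * (δ ^ 2 / (M * θ3)))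
      ((θ1 + θ3) * (θ1 + θ2) / (2 * θ1 * (θ1 + 2 * θ2)) * (δ ^ 2 / (M * θ3))))
 :
    0 < θ1 * Chat - 3 * B1 - θ1 * B1 * b := by
  set s := Real.sqrt (μ ^ 2 + 2 * σ ^ 2 * δ) with hs
  have hσ2 : 0 < σ ^ 2 := by positivity
  have hσδ : 0 < 2 * σ ^ 2 * δ := by positivity
  have hs2 : s ^ 2 = μ ^ 2 + 2 * σ ^ 2 * δ := Real.sq_sqrt (by positivity)
  have hs0 : 0 ≤ s := Real.sqrt_nonneg _
  have hsμ : μ < s := by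
    apply Real.lt_sqrt_of_sq_lt; linarith
  have h1 : 0 < θ1 := by rw [hθ1]; exact div_pos (by linarith) hσ2
  have h2 : 0 < θ2 := by rw [hθ2]; exact div_pos (by linarith) hσ2
  have h3 : 0 < θ3 := by
    rw [hθ3]
    apply div_pos _ hσ2
    have : |μ - M| < Real.sqrt ((μ - M) ^ 2 + 2 * σ ^ 2 * δ) := by
      apply Real.lt_sqrt_of_sq_lt; rw [sq_abs]; linarith
    linarith [neg_abs_le (μ - M)]
  have e1 : σ ^ 2 * θ1 = s - μ := by rw [hθ1]; field_simp; ring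
  have e2 : σ ^ 2 * θ2 = s + μ := by rw [hθ2]; field_simp; ring
  have es : μ + σ ^ 2 * θ1 = s := by linarith
  have es2 : s = σ ^ 2 * (θ1 + θ2) / 2 := by linarith
  have eδ : δ = σ ^ 2 * θ1 * θ2 / 2 := by
    have : σ ^ 2 * (σ ^ 2 * θ1 * θ2) = σ ^ 2 * (2 * δ) := by
      calc σ ^ 2 * (σ ^ 2 * θ1 * θ2) = (σ ^ 2 * θ1) * (σ ^ 2 * θ2) := by ring
        _ = σ ^ 2 * (2 * δ) := by rw [e1, e2]; linarith
    have := mul_left_cancel₀ hσ2.ne' this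
    linarith
  have hspos : 0 < s := by linarith
  have hE : 1 ≤ Real.exp (θ1 * b) := Real.one_le_exp (by positivity)
  have hF0 : 0 < Real.exp (-θ2 * b) := Real.exp_pos _
  have hF : θ2 * b * Real.exp (-θ2 * b) ≤ 1 - Real.exp (-θ2 * b) := by
    have h := Real.add_one_le_exp (θ2 * b)
    have h' : Real.exp (θ2 * b) * Real.exp (-θ2 * b) = 1 := by
      rw [← Real.exp_add]; simp
    linear_combination mul_le_mul_of_nonneg_right h hF0.le + h'
  rw [es] at hB1
  generalize Real.exp (θ1 * b) = E at *
  generalize Real.exp (-θ2 * b) = F at *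
  have hx0 : 0 ≤ θ2 * b * F := by positivity
  have hF1 : F ≤ 1 := by linarith
  have hE0 : 0 < E := by linarith
  have hEF : 0 ≤ E - F := by linarith
  have hG : 0 < (θ1 + θ3) * E + (θ2 - θ3) * F := by
    have d1 : 0 ≤ θ3 * (E - F) := by positivity
    have d2 : 0 < θ1 * E := by positivity
    have d3 : 0 < θ2 * F := by positivity
    linear_combination d1 + d2 + d3
  have hD : 0 < θ1 * E + θ2 * F := by positivity
  obtain ⟨t, ht⟩ : ∃ t, t = lam * (M * θ3) / (δ ^ 2 * (θ1 + θ2)) := ⟨_, rfl⟩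
  have ht0 : 0 < t := by rw [ht]; positivity
  have hlt : lam * (M * θ3) = t * (δ ^ 2 * (θ1 + θ2)) := by
    rw [ht]; field_simp
  have hMθ : 0 < M * θ3 := by positivity
  have hd : 0 < δ ^ 2 * (θ1 + θ2) := by positivity
  have k1 : t * (θ1 + 3 * θ2) ≤ 1 := by
    have h := le_trans hlam (min_le_left _ _)
    rw [div_mul_div_comm, le_div_iff₀ (by positivity)] at h
    have : (t * (θ1 + 3 * θ2)) * (δ ^ 2 * (θ1 + θ2)) ≤ 1 * (δ ^ 2 * (θ1 + θ2)) := by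
      linear_combination h - (θ1 + 3 * θ2) * hlt
    exact le_of_mul_le_mul_right this hd
  have k2 : t * (2 * θ1 * (θ1 + 2 * θ2)) ≤ θ1 + θ3 := by
    have h := le_trans hlam (min_le_right _ _)
    rw [div_mul_div_comm, le_div_iff₀ (by positivity)] at h
    have : (t * (2 * θ1 * (θ1 + 2 * θ2))) * (δ ^ 2 * (θ1 + θ2))
        ≤ (θ1 + θ3) * (δ ^ 2 * (θ1 + θ2)) := by
      linear_combination h - (2 * θ1 * (θ1 + 2 * θ2)) * hlt
    exact le_of_mul_le_mul_right this hd
  have key : t * θ2 * (2 * θ1 * E + F * (2 * θ1 * θ2 * b + 3 * θ2 - θ1))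
      < (θ1 + θ3) * E + (θ2 - θ3) * F := by
    have a1 := mul_le_mul_of_nonneg_right k2 hEF
    have a2 := mul_le_mul_of_nonneg_right k1 (show 0 ≤ (θ1 + θ2) * F by positivity)
    have a3 : 0 < E * (2 * θ1 ^ 2 + 2 * θ1 * θ2) + F * (-θ1 ^ 2 + θ1 * θ2)
        - 2 * θ1 * θ2 * (θ2 * b * F) := by
      have c1 : 0 ≤ θ1 * θ2 * (E - θ2 * b * F) :=
        mul_nonneg (by positivity) (by linarith)
      have c2 : 0 ≤ θ1 ^ 2 * (E - F) := by positivity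
      have c3 : 0 < θ1 ^ 2 * E := by positivity
      have c4 : 0 < θ1 * θ2 * F := by positivity
      linear_combination 2 * c1 + c2 + c3 + c4
    have a4 := mul_pos ht0 a3
    linear_combination a1 + a2 + a4
  have hB : B1 * ((θ1 + θ3) * E + (θ2 - θ3) * F) = θ1 * (t * θ2) := by
    have h5 : B1 * ((θ1 + θ3) * E + (θ2 - θ3) * F) = lam * (M * θ3) / (δ * s) := by
      rw [hB1, hC]; field_simp
    rw [h5, hlt, div_eq_iff (by positivity), es2, eδ]; ring
  have hfin : 0 < θ1 - B1 * (2 * θ1 * E + F * (2 * θ1 * θ2 * b + 3 * θ2 - θ1)) := by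
    have h6 := mul_lt_mul_of_pos_left key h1
    refine pos_of_mul_pos_left (b := (θ1 + θ3) * E + (θ2 - θ3) * F) ?_ hG.le
    linear_combination h6 + (2 * θ1 * E + F * (2 * θ1 * θ2 * b + 3 * θ2 - θ1)) * hB
  have hres : θ1 * Chat - 3 * B1 - θ1 * B1 * b =
      (θ1 - B1 * (2 * θ1 * E + F * (2 * θ1 * θ2 * b + 3 * θ2 - θ1))) / (θ1 * E + θ2 * F) := by
    rw [hChat, eq_div_iff hD.ne']
    field_simp
    ring
  rw [hres]
  exact div_pos hfin hD
end

section
/- Fix b > 0, let C = C(b), B₁ = λC/(μ+σ²θ₁) and Ĉ = [1 + (θ₁b + 1)B₁e^{θ₁b} − (θ₂b − 1)B₁e^{−θ₂b}] / (θ₁e^{θ₁b} + θ₂e^{−θ₂b}), and define V₄(x) = (Ĉ − B₁x)e^{θ₁x} − (Ĉ + B₁x)e^{−θ₂x} for x ∈ [0,b). If 0 < λ ≤ min{ (θ₁+θ₂)/(θ₁+3θ₂) · δ²/(Mθ₃), (θ₁+θ₃)(θ₁+θ₂)/(2θ₁(θ₁+2θ₂)) · δ²/(Mθ₃) }, then the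 third derivative V₄‴(x) = θ₁²(θ₁Ĉ − 3B₁ − θ₁B₁x)e^{θ₁x} + θ₂²(θ₂Ĉ − 3B₁ + θ₂B₁x)e^{−θ₂x} is strictly positive for every x ∈ [0,b). -/
open Real

lemma key_alg (a c t v y X : ℝ) (ha : 0 < a) (hac : a < c) (ht : 0 < t) (htc : t < c)
    (hv : 0 < v) (hv1 : v ≤ 1) (hy : 0 ≤ y) (hy1 : y ≤ 1 - v)
    (h1 : X * ((a + t) + (c - t) * v) * (a + 3 * c) ≤ a * c)
    (h2 : X * ((a + t) + (c - t) * v) * (2 * (a + 2 * c)) ≤ c * (a + t)) :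
    X * (2 * a + (2 * a * y + (3 * c - a) * v)) < a := by
  have hc : 0 < c := ha.trans hac
  set q := (a + t) + (c - t) * v with hq
  have hq0 : 0 < q := by
    have : 0 < (c - t) * v := mul_pos (by linarith) hv
    linarith
  set w := 2 * a * y + (3 * c - a) * v with hw
  have hw0 : 0 < w := by
    have h3 : 0 < (3 * c - a) * v := mul_pos (by linarith) hv
    have h4 : 0 ≤ 2 * a * y := by positivity
    linarith
  have hwle : w ≤ 2 * a * (1 - v) + (3 * c - a) * v := by
    have := mul_le_mul_of_nonneg_left hy1 (by positivity : 0 ≤ 2 * a)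
    linarith
  have hcw : c * (2 * a + w) ≤ 4 * a * c + 3 * c * (c - a) * v := by
    have := mul_le_mul_of_nonneg_left hwle hc.le
    nlinarith
  suffices h : X * q * (2 * a + w) < a * q by
    by_contra hn
    push Not at hn
    have := mul_le_mul_of_nonneg_right hn hq0.le
    linarith [this, (by ring : X * (2 * a + w) * q = X * q * (2 * a + w))]
  rcases le_total (a * (a + c)) (t * (a + 3 * c)) with hcase | hcase
  · have e1 := mul_le_mul_of_nonneg_right h1 (by positivity : 0 ≤ 2 * a + w)
    have e2 : c * (2 * a + w) < (a + 3 * c) * q := by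
      have e3 := mul_le_mul_of_nonneg_right hcase (by linarith : 0 ≤ 1 - v)
      have e4 : 0 < a * (3 * c - a) * v := mul_pos (mul_pos ha (by linarith)) hv
      have e5 : 0 < a ^ 2 := by positivity
      rw [hq]
      linarith [(by ring : (a + 3 * c) * (a + t + (c - t) * v) = (a + 3 * c) * (a + c * v) + t * (a + 3 * c) * (1 - v)), (by ring : (a + 3 * c) * (a + c * v) + a * (a + c) * (1 - v) = 2 * a ^ 2 + a * (3 * c - a) * v + (4 * a * c + 3 * c * (c - a) * v))]
    have e6 := mul_lt_mul_of_pos_left e2 ha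
    have e7 : 0 < a + 3 * c := by positivity
    by_contra hn
    push Not at hn
    have := mul_le_mul_of_nonneg_right hn e7.le
    linarith
  · have e1 := mul_le_mul_of_nonneg_right h2 (by positivity : 0 ≤ 2 * a + w)
    have e7 : 0 < a + 3 * c := by positivity
    have hcoef : 0 < 2 * a * (a + 2 * c) * (c - t) - 3 * c * (c - a) * (a + t) := by
      have hk : 0 ≤ 2 * a * (a + 2 * c) + 3 * c * (c - a) := by
        have : 0 ≤ 3 * c * (c - a) := mul_nonneg (by positivity) (by linarith)
        positivity
      have f1 := mul_le_mul_of_nonneg_right hcase hk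
      have f2 : 0 < 2 * a * (a + 2 * c) * (a * (3 * c - a)) :=
        mul_pos (by positivity) (mul_pos ha (by linarith))
      have : 0 < (2 * a * (a + 2 * c) * (c - t) - 3 * c * (c - a) * (a + t)) * (a + 3 * c) := by
        nlinarith
      exact pos_of_mul_pos_left this e7.le
    have e2 : c * (a + t) * (2 * a + w) < 2 * (a + 2 * c) * (a * q) := by
      have f1 := mul_le_mul_of_nonneg_right hcw (by positivity : 0 ≤ a + t)
      have f2 := mul_pos hcoef hv
      have f3 : 0 < 2 * a ^ 2 * (a + t) := by positivity
      rw [hq]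
      linarith
    have e8 : 0 < 2 * (a + 2 * c) := by positivity
    by_contra hn
    push Not at hn
    have := mul_le_mul_of_nonneg_right hn e8.le
    linarith

lemma hd (p k r s A B : ℝ) (x : ℝ) : HasDerivAt (fun x => (p - r * x) * exp (A * x) + (k + s * x) * exp (B * x))
    (((A * p - r) - (A * r) * x) * exp (A * x) + ((B * k + s) + (B * s) * x) * exp (B * x)) x := by
  have h1 : HasDerivAt (fun x : ℝ => exp (A * x)) (exp (A * x) * (A * 1)) x :=
    ((hasDerivAt_id x).const_mul A).exp
  have h2 : HasDerivAt (fun x : ℝ => exp (B * x)) (exp (B * x) * (B * 1)) x :=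
    ((hasDerivAt_id x).const_mul B).exp
  have h3 : HasDerivAt (fun x : ℝ => p - r * x) (-(r * 1)) x :=
    ((hasDerivAt_id x).const_mul r).const_sub p
  have h4 : HasDerivAt (fun x : ℝ => k + s * x) (s * 1) x :=
    ((hasDerivAt_id x).const_mul s).const_add k
  refine ((h3.fun_mul h1).fun_add (h4.fun_mul h2)).congr_deriv ?_
  ring

lemma hd_deriv (p k r s A B : ℝ) :
    deriv (fun x => (p - r * x) * exp (A * x) + (k + s * x) * exp (B * x)) =
    fun x => ((A * p - r) - (A * r) * x) * exp (A * x)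
      + ((B * k + s) + (B * s) * x) * exp (B * x) :=
  funext fun x => (hd p k r s A B x).deriv

set_option maxHeartbeats 2000000 in
theorem pseudo_exponential_V4_third_derivative_pos
    (σ μ M δ : ℝ) (hσ : 0 < σ) (hμ : 0 < μ) (hM : 0 < M) (hδ : 0 < δ)
    (lam : ℝ) (hlam0 : 0 < lam) (hlamδ : lam < δ)
    (θ1 θ2 θ3 : ℝ)
    (hθ1 : θ1 = (-μ + Real.sqrt (μ ^ 2 + 2 * σ ^ 2 * δ)) / σ ^ 2)
    (hθ2 : θ2 = (μ + Real.sqrt (μ ^ 2 + 2 * σ ^ 2 * δ)) / σ ^ 2)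
    (hθ3 : θ3 = ((μ - M) + Real.sqrt ((μ - M) ^ 2 + 2 * σ ^ 2 * δ)) / σ ^ 2)
    (b : ℝ) (hb : 0 < b)
    (C B1 Chat : ℝ)
    (hC : C = (M * θ3 / δ) *
      ((θ1 + θ3) * Real.exp (θ1 * b) + (θ2 - θ3) * Real.exp (-θ2 * b))⁻¹)
    (hB1 : B1 = lam * C / (μ + σ ^ 2 * θ1))
    (hChat : Chat = (1 + (θ1 * b + 1) * B1 * Real.exp (θ1 * b)
        - (θ2 * b - 1) * B1 * Real.exp (-θ2 * b)) /
      (θ1 * Real.exp (θ1 * b) + θ2 * Real.exp (-θ2 * b)))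
    (V4 : ℝ → ℝ)
    (hV4 : ∀ x, V4 x = (Chat - B1 * x) * Real.exp (θ1 * x)
      - (Chat + B1 * x) * Real.exp (-θ2 * x))
    (hlam : lam ≤ min ((θ1 + θ2) / (θ1 + 3 * θ2) * (δ ^ 2 / (M * θ3)))
      ((θ1 + θ3) * (θ1 + θ2) / (2 * θ1 * (θ1 + 2 * θ2)) * (δ ^ 2 / (M * θ3))))
 :
    ∀ x ∈ Set.Ico (0 : ℝ) b,
      deriv (deriv (deriv V4)) x =
        θ1 ^ 2 * (θ1 * Chat - 3 * B1 - θ1 * B1 * x) * Real.exp (θ1 * x)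
        + θ2 ^ 2 * (θ2 * Chat - 3 * B1 + θ2 * B1 * x) * Real.exp (-θ2 * x) ∧
      0 < θ1 ^ 2 * (θ1 * Chat - 3 * B1 - θ1 * B1 * x) * Real.exp (θ1 * x)
        + θ2 ^ 2 * (θ2 * Chat - 3 * B1 + θ2 * B1 * x) * Real.exp (-θ2 * x) := by
  intro x hx
  obtain ⟨hx0, hxb⟩ := hx
  constructor
  · have e0 : V4 = fun x => (Chat - B1 * x) * exp (θ1 * x) + (-Chat + (-B1) * x) * exp (-θ2 * x) := by
      funext y; rw [hV4]; ring
    rw [e0, hd_deriv, hd_deriv, hd_deriv]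
    ring
  -- parameter facts
  have hs2 : 0 < σ ^ 2 := by positivity
  have hS2 := Real.sq_sqrt (by positivity : 0 ≤ μ ^ 2 + 2 * σ ^ 2 * δ)
  have hT2 := Real.sq_sqrt (by positivity : 0 ≤ (μ - M) ^ 2 + 2 * σ ^ 2 * δ)
  have hpos : 0 < 2 * σ ^ 2 * δ := by positivity
  have hSμ : μ < √(μ ^ 2 + 2 * σ ^ 2 * δ) := Real.lt_sqrt_of_sq_lt (by linarith)
  have hTm : |μ - M| < √((μ - M) ^ 2 + 2 * σ ^ 2 * δ) :=
    Real.lt_sqrt_of_sq_lt (by rw [sq_abs]; linarith)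
  set S := √(μ ^ 2 + 2 * σ ^ 2 * δ)
  set T := √((μ - M) ^ 2 + 2 * σ ^ 2 * δ)
  have hθ1' : σ ^ 2 * θ1 = -μ + S := by rw [hθ1]; field_simp
  have hθ2' : σ ^ 2 * θ2 = μ + S := by rw [hθ2]; field_simp
  have hθ3' : σ ^ 2 * θ3 = μ - M + T := by rw [hθ3]; field_simp
  have ha : 0 < θ1 := by rw [hθ1]; exact div_pos (by linarith) hs2
  have ht : 0 < θ3 := by
    rw [hθ3]; exact div_pos (by linarith [neg_abs_le (μ - M)]) hs2
  have hac : θ1 < θ2 := by rw [hθ1, hθ2]; gcongr; linarith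
  have hc : 0 < θ2 := ha.trans hac
  have htc : θ3 < θ2 := by
    have hTS : T < M + S := by
      apply lt_of_pow_lt_pow_left₀ 2 (by linarith)
      rw [hT2]; nlinarith [mul_pos hM (by linarith : 0 < S + μ)]
    rw [hθ3, hθ2]; gcongr ?_ / _; linarith
  have hprod : σ ^ 2 * (θ1 * θ2) = 2 * δ := by
    have : σ ^ 2 * (σ ^ 2 * (θ1 * θ2)) = σ ^ 2 * (2 * δ) := by
      calc _ = (σ ^ 2 * θ1) * (σ ^ 2 * θ2) := by ring
        _ = _ := by rw [hθ1', hθ2']; nlinarith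
    exact mul_left_cancel₀ hs2.ne' this
  have hSac : μ + σ ^ 2 * θ1 = S := by linarith
  have hS0 : 0 < S := by linarith
  have hSδ : S * (θ1 * θ2) = δ * (θ1 + θ2) := by
    have h2S : 2 * S = σ ^ 2 * (θ1 + θ2) := by linarith
    linear_combination (θ1 * θ2) / 2 * h2S + (θ1 + θ2) / 2 * hprod
  rw [hSac] at hB1
  obtain ⟨hl1, hl2⟩ := le_min_iff.mp hlam
  clear_value S T
  have hFE : exp (-θ2 * b) = exp (θ1 * b) * exp (-((θ1 + θ2) * b)) := by
    rw [← Real.exp_add]; congr 1; ring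
  have hv0 := Real.exp_pos (-((θ1 + θ2) * b))
  have hE0 := Real.exp_pos (θ1 * b)
  have hu : 0 < (θ1 + θ2) * b := by positivity
  have hv1 : exp (-((θ1 + θ2) * b)) ≤ 1 := Real.exp_le_one_iff.mpr (by linarith)
  have huv : (θ1 + θ2) * b * exp (-((θ1 + θ2) * b)) ≤ 1 - exp (-((θ1 + θ2) * b)) := by
    have h := mul_le_mul_of_nonneg_right (Real.add_one_le_exp ((θ1 + θ2) * b)) hv0.le
    rw [← Real.exp_add] at h
    simp only [add_neg_cancel, Real.exp_zero] at h
    linarith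
  rw [hFE] at hC hChat
  set E := exp (θ1 * b)
  set v := exp (-((θ1 + θ2) * b))
  clear_value E v
  set q := (θ1 + θ3) + (θ2 - θ3) * v with hq
  have hq0 : 0 < q := by
    have : 0 < (θ2 - θ3) * v := mul_pos (by linarith) hv0
    linarith
  have hC' : C * (E * q) = M * θ3 / δ := by
    have : (θ1 + θ3) * E + (θ2 - θ3) * (E * v) = E * q := by rw [hq]; ring
    rw [hC, this]; field_simp
  have hC0 : 0 < C := pos_of_mul_pos_left (by rw [hC']; positivity) (by positivity : 0 ≤ E * q)
  have hB0 : 0 < B1 := by rw [hB1]; positivity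
  have hX : B1 * E * q * (θ1 + θ2) = lam * (M * θ3) / δ ^ 2 * (θ1 * θ2) := by
    have e1 : B1 * S = lam * C := by rw [hB1]; field_simp
    have e2 : B1 * E * q * S = lam * (M * θ3 / δ) := by
      rw [← hC']; linear_combination E * q * e1
    have e3 : δ * (B1 * E * q * (θ1 + θ2)) = lam * (M * θ3 / δ) * (θ1 * θ2) := by
      linear_combination (-(B1 * E * q)) * hSδ + θ1 * θ2 * e2
    field_simp at e3 ⊢
    linarith
  have hMt : 0 < M * θ3 := by positivity
  have hK1 : lam * (M * θ3) / δ ^ 2 ≤ (θ1 + θ2) / (θ1 + 3 * θ2) := by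
    rw [div_le_iff₀ (by positivity)]
    calc _ ≤ _ := mul_le_mul_of_nonneg_right hl1 hMt.le
      _ = _ := by field_simp
  have hK2 : lam * (M * θ3) / δ ^ 2 ≤ (θ1 + θ3) * (θ1 + θ2) / (2 * θ1 * (θ1 + 2 * θ2)) := by
    rw [div_le_iff₀ (by positivity)]
    calc _ ≤ _ := mul_le_mul_of_nonneg_right hl2 hMt.le
      _ = _ := by field_simp
  set K := lam * (M * θ3) / δ ^ 2
  rw [le_div_iff₀ (by positivity)] at hK1 hK2
  have hsum : 0 < θ1 + θ2 := by positivity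
  have hkey := key_alg θ1 θ2 θ3 v (θ2 * b * v) (B1 * E) ha hac ht htc hv0 hv1 (by positivity)
    (by
      have : 0 < θ1 * b * v := by positivity
      nlinarith)
    (by
      refine le_of_mul_le_mul_right ?_ hsum
      have := mul_le_mul_of_nonneg_left hK1 (by positivity : 0 ≤ θ1 * θ2)
      linear_combination this + (θ1 + 3 * θ2) * hX)
    (by
      refine le_of_mul_le_mul_right ?_ hsum
      have := mul_le_mul_of_nonneg_left hK2 hc.le
      linear_combination this + (2 * (θ1 + 2 * θ2)) * hX)
  have hG : 0 < θ1 * E + θ2 * (E * v) := by positivity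
  have hCh : Chat * (θ1 * E + θ2 * (E * v)) = 1 + (θ1 * b + 1) * B1 * E
        - (θ2 * b - 1) * B1 * (E * v) := by rw [hChat]; field_simp
  have hP : 0 < θ1 * Chat - 3 * B1 - θ1 * B1 * b := by
    refine pos_of_mul_pos_left (b := θ1 * E + θ2 * (E * v)) ?_ hG.le
    linear_combination hkey - θ1 * hCh
  have hBx : θ1 * B1 * x < θ1 * B1 * b := mul_lt_mul_of_pos_left hxb (by positivity)
  have hBb : 0 < θ1 * B1 * b := by positivity
  have hChat0 : 0 < Chat := pos_of_mul_pos_right (by linarith : 0 < θ1 * Chat) ha.le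
  have hcC : θ1 * Chat < θ2 * Chat := mul_lt_mul_of_pos_right hac hChat0
  have hBx0 : 0 ≤ θ2 * B1 * x := by positivity
  have p1 : 0 < θ1 * Chat - 3 * B1 - θ1 * B1 * x := by linarith
  have p2 : 0 < θ2 * Chat - 3 * B1 + θ2 * B1 * x := by linarith
  positivity
end
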